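/- arXiv:2102.02663 — 6 statements merged into one kernel-verified Lean document; each statement's English description precedes it below -/
import Mathlib

section
/- For ν > -1/2, as n → ∞ the integral I_n = ∫_0^∞ (e^{-x} Γ(1+ν) I_ν(x)/(x/2)^ν)^n dx satisfies I_n = 1/n + 1/(2(1+ν)n²) + O(1/n³). -/
open Real Filter Asymptotics

/-- Modified Bessel function of the first kind. -/
noncomputable def besselI (ν x : ℝ) : ℝ :=
  ∑' k : ℕ, (x / 2) ^ (ν + 2 * (k : ℝ)) / (Real.Gamma (ν + k + 1) * k.factorial)

namespace BallBessel

/-- Taylor coefficients of the normalized Bessel function. -/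
noncomputable def d (ν : ℝ) (k : ℕ) : ℝ :=
  Real.Gamma (1 + ν) / (Real.Gamma (ν + k + 1) * k.factorial) / 4 ^ k

/-- The normalized Bessel function. -/
noncomputable def F (ν x : ℝ) : ℝ := ∑' k : ℕ, d ν k * x ^ (2 * k)

variable {ν : ℝ}

lemma d_pos (hν : -1/2 < ν) (k : ℕ) : 0 < d ν k := by
  have hk : (0 : ℝ) ≤ k := k.cast_nonneg
  have h1 : 0 < Real.Gamma (1 + ν) := Real.Gamma_pos_of_pos (by linarith)
  have h2 : 0 < Real.Gamma (ν + k + 1) := Real.Gamma_pos_of_pos (by linarith)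
  unfold d
  positivity

lemma d_zero (hν : -1/2 < ν) : d ν 0 = 1 := by
  have h1 : 0 < Real.Gamma (1 + ν) := Real.Gamma_pos_of_pos (by linarith)
  unfold d
  rw [show ν + ((0 : ℕ) : ℝ) + 1 = 1 + ν by push_cast; ring]
  simp [h1.ne']

lemma d_succ (hν : -1/2 < ν) (k : ℕ) :
    d ν (k + 1) = d ν k / (4 * (k + 1) * (ν + k + 1)) := by
  have hk : (0 : ℝ) ≤ k := k.cast_nonneg
  have h0 : 0 < ν + k + 1 := by linarith
  have h2 : 0 < Real.Gamma (ν + k + 1) := Real.Gamma_pos_of_pos h0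
  unfold d
  rw [show ν + ((k + 1 : ℕ) : ℝ) + 1 = (ν + k + 1) + 1 by push_cast; ring,
    Real.Gamma_add_one h0.ne', Nat.factorial_succ]
  push_cast
  field_simp
  ring

lemma d_one (hν : -1/2 < ν) : d ν 1 = 1 / (4 * (1 + ν)) := by
  have := d_succ hν 0
  rw [d_zero hν] at this
  simp only [zero_add] at this
  rw [this]
  push_cast
  congr 1
  ring

lemma d_le_exp (hν : -1/2 < ν) (k : ℕ) :
    d ν k ≤ (1 / (4 * (1 + ν))) ^ k / k.factorial := by
  induction k with
  | zero => simp [d_zero hν]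
  | succ k ih =>
    have hk : (0 : ℝ) ≤ k := k.cast_nonneg
    have h1 : 0 < 1 + ν := by linarith
    rw [d_succ hν, pow_succ, Nat.factorial_succ]
    have h3 : 4 * (k + 1) * (1 + ν) ≤ 4 * ((k : ℝ) + 1) * (ν + k + 1) := by
      refine mul_le_mul_of_nonneg_left ?_ (by positivity)
      linarith
    calc d ν k / (4 * (k + 1) * (ν + k + 1))
        ≤ ((1 / (4 * (1 + ν))) ^ k / k.factorial) / (4 * (k + 1) * (1 + ν)) := by
          gcongr
      _ = _ := by push_cast; field_simp

/-- The decay exponent. -/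
noncomputable def δ (ν : ℝ) : ℝ := min 1 (ν + 1/2)

lemma δ_pos (hν : -1/2 < ν) : 0 < δ ν := lt_min one_pos (by linarith)
lemma δ_le : δ ν ≤ 1 := min_le_left _ _
lemma δ_le' : δ ν ≤ ν + 1/2 := min_le_right _ _

lemma d_le_cosh (hν : -1/2 < ν) (k : ℕ) :
    d ν k ≤ (1 / (2 * (k : ℝ) + 1)) ^ δ ν / (2 * k).factorial := by
  induction k with
  | zero => simp [d_zero hν]
  | succ k ih =>
    have hk : (0 : ℝ) ≤ k := k.cast_nonneg
    have h0 : 0 < ν + k + 1 := by linarith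
    set m : ℝ := 2 * (k : ℝ) + 1 with hm
    have hm0 : 0 < m := by positivity
    have hδ := δ_pos hν
    have e1 : 2 * ((k + 1 : ℕ) : ℝ) + 1 = m + 2 := by rw [hm]; push_cast; ring
    have e2 : (((2 * (k + 1)).factorial : ℕ) : ℝ) = (m + 1) * m * (2 * k).factorial := by
      rw [show 2 * (k + 1) = (2 * k + 1) + 1 by ring, Nat.factorial_succ, Nat.factorial_succ]
      push_cast; rw [hm]; ring
    have b1 : (1 + 2 / m) ^ δ ν ≤ 1 + δ ν * (2 / m) :=
      rpow_one_add_le_one_add_mul_self (by have : 0 ≤ 2 / m := by positivity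
                                           linarith) hδ.le δ_le
    have b2 : m * (1 + 2 / m) ^ δ ν ≤ 2 * (ν + k + 1) := by
      calc m * (1 + 2 / m) ^ δ ν ≤ m * (1 + δ ν * (2 / m)) := by gcongr
        _ = m + 2 * δ ν := by field_simp
        _ ≤ _ := by rw [hm]; linarith [δ_le' (ν := ν)]
    have e3 : (1 / m) ^ δ ν = (1 / (m + 2)) ^ δ ν * (1 + 2 / m) ^ δ ν := by
      rw [← Real.mul_rpow (by positivity) (by positivity)]
      congr 1
      field_simp
    rw [d_succ hν, e1, e2]
    rw [div_le_iff₀ (by positivity)]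
    refine ih.trans ?_
    rw [e3, div_le_iff₀ (by positivity)]
    have hP : 0 < (1 / (m + 2)) ^ δ ν := by positivity
    have hf : (0 : ℝ) < (2 * k).factorial := by positivity
    have : (1 / (m + 2)) ^ δ ν / ((m + 1) * m * (2 * k).factorial) *
        (4 * (k + 1) * (ν + k + 1)) * (2 * k).factorial =
        (1 / (m + 2)) ^ δ ν * (2 * (ν + k + 1) / m) := by
      have : (k : ℝ) + 1 = (m + 1) / 2 := by rw [hm]; ring
      rw [add_assoc ν, this]
      field_simp
      ring
    rw [this]
    gcongr
    rw [le_div_iff₀ hm0]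
    linarith

lemma summable_F (hν : -1/2 < ν) (x : ℝ) : Summable fun k : ℕ => d ν k * x ^ (2 * k) := by
  refine Summable.of_nonneg_of_le (fun k => ?_) (fun k => ?_)
    (Real.summable_pow_div_factorial (x ^ 2 * (1 / (4 * (1 + ν)))))
  · have := d_pos hν k
    rw [pow_mul]; positivity
  · rw [mul_pow, pow_mul]
    have := d_le_exp hν k
    calc _ ≤ (1 / (4 * (1 + ν))) ^ k / k.factorial * (x ^ 2) ^ k := by gcongr
      _ = _ := by ring

lemma F_le_exp (hν : -1/2 < ν) (x : ℝ) : F ν x ≤ Real.exp (1 / (4 * (1 + ν)) * x ^ 2) := by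
  rw [Real.exp_eq_exp_ℝ, NormedSpace.exp_eq_tsum_div]
  refine (summable_F hν x).tsum_le_tsum (fun k => ?_) (Real.summable_pow_div_factorial _)
  rw [mul_pow, pow_mul]
  have := d_le_exp hν k
  calc _ ≤ (1 / (4 * (1 + ν))) ^ k / k.factorial * (x ^ 2) ^ k := by gcongr
      _ = _ := by ring

lemma le_F (hν : -1/2 < ν) (x : ℝ) : 1 + 1 / (4 * (1 + ν)) * x ^ 2 ≤ F ν x := by
  have := (summable_F hν x).sum_le_tsum (Finset.range 2) (fun k _ => by
    have := d_pos hν k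
    rw [pow_mul]; positivity)
  simpa [Finset.sum_range_succ, d_zero hν, d_one hν, F] using this

lemma F_le_decay (hν : -1/2 < ν) {x : ℝ} (hx : 0 < x) : F ν x ≤ Real.exp x * x ^ (-δ ν) := by
  have hδ := δ_pos hν
  have hδ1 := δ_le (ν := ν)
  have hc := Real.hasSum_cosh x
  have hs := Real.hasSum_sinh x
  have key : F ν x ≤ x ^ (-δ ν) * ((1 - δ ν) * Real.cosh x + δ ν * Real.sinh x) := by
    refine hasSum_le (fun k => ?_) (summable_F hν x).hasSum
      (((hc.mul_left (1 - δ ν)).add (hs.mul_left (δ ν))).mul_left (x ^ (-δ ν)))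
    have hk : (0 : ℝ) ≤ k := k.cast_nonneg
    set m : ℝ := 2 * (k : ℝ) + 1 with hm
    have hm0 : 0 < m := by positivity
    have h1 := d_le_cosh hν k
    rw [← hm] at h1
    have h2 : (x / m) ^ δ ν ≤ (1 - δ ν) + δ ν * (x / m) := by
      have := rpow_one_add_le_one_add_mul_self (s := x / m - 1) (p := δ ν)
        (by have : 0 < x / m := by positivity
            linarith) hδ.le hδ1
      rw [add_sub_cancel] at this
      linarith
    have h3 : (1 / m) ^ δ ν = x ^ (-δ ν) * (x / m) ^ δ ν := by
      rw [Real.rpow_neg hx.le, ← Real.inv_rpow hx.le,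
        ← Real.mul_rpow (by positivity) (by positivity)]
      congr 1
      field_simp
    have e2 : (((2 * k + 1).factorial : ℕ) : ℝ) = m * (2 * k).factorial := by
      rw [Nat.factorial_succ]; push_cast; rw [hm]
    rw [h3] at h1
    calc d ν k * x ^ (2 * k)
        ≤ x ^ (-δ ν) * ((1 - δ ν) + δ ν * (x / m)) / (2 * k).factorial * x ^ (2 * k) := by
          refine mul_le_mul_of_nonneg_right (h1.trans ?_) (by positivity)
          gcongr
      _ = _ := by
          rw [e2, pow_succ]
          field_simp
  refine key.trans ?_
  rw [mul_comm (Real.exp x)]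
  gcongr
  have e := Real.cosh_add_sinh x
  have hs0 : 0 ≤ Real.sinh x := Real.sinh_nonneg_iff.2 hx.le
  have hc0 := Real.cosh_pos x
  nlinarith

lemma measurable_F (hν : -1/2 < ν) : Measurable (F ν) := by
  refine measurable_of_tendsto_metrizable
    (f := fun N x => ∑ k ∈ Finset.range N, d ν k * x ^ (2 * k)) (fun N => ?_) ?_
  · fun_prop
  · rw [tendsto_pi_nhds]
    intro x
    exact (summable_F hν x).hasSum.tendsto_sum_nat

lemma integrand_eq {x : ℝ} (hx : 0 < x) :
    Real.exp (-x) * Real.Gamma (1 + ν) * besselI ν x / (x / 2) ^ ν = Real.exp (-x) * F ν x := by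
  have h2 : 0 < x / 2 := by positivity
  rw [mul_assoc, mul_div_assoc]
  congr 1
  unfold besselI F
  rw [← tsum_mul_left, ← tsum_div_const]
  congr 1
  funext k
  rw [Real.rpow_add h2, show 2 * (k : ℝ) = ((2 * k : ℕ) : ℝ) by push_cast; ring,
    Real.rpow_natCast, div_pow, pow_mul 2 2 k]
  have : 0 < (x / 2) ^ ν := by positivity
  unfold d
  norm_num
  field_simp

lemma int_pow_exp (m : ℕ) {r : ℝ} (hr : 0 < r) :
    MeasureTheory.IntegrableOn (fun x : ℝ => x ^ m * Real.exp (-(r * x))) (Set.Ioi 0) ∧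
    ∫ x in Set.Ioi (0 : ℝ), x ^ m * Real.exp (-(r * x)) = m.factorial / r ^ (m + 1) := by
  constructor
  · have := integrableOn_rpow_mul_exp_neg_mul_rpow (p := 1) (s := m) (b := r)
      (by have : (0 : ℝ) ≤ m := m.cast_nonneg
          linarith) one_pos hr
    simpa using this
  · have := Real.integral_rpow_mul_exp_neg_mul_Ioi (a := m + 1) (r := r) (by positivity) hr
    simp only [add_sub_cancel_right, Real.rpow_natCast, Real.Gamma_nat_eq_factorial] at this
    rw [this]
    rw [show (m : ℝ) + 1 = ((m + 1 : ℕ) : ℝ) by push_cast; ring, Real.rpow_natCast,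
      one_div, inv_pow, div_eq_inv_mul]


lemma lower (hν : -1/2 < ν) {n : ℝ} (hn : 1 ≤ n) (x : ℝ) :
    Real.exp (-(n * x)) + n * (1 / (4 * (1 + ν))) * (x ^ 2 * Real.exp (-(n * x))) ≤
      (Real.exp (-x) * F ν x) ^ n := by
  have hν1 : 0 < 1 + ν := by linarith
  have hb : 0 < 1 / (4 * (1 + ν)) := by positivity
  set b := 1 / (4 * (1 + ν)) with hbd
  have h1 := le_F hν x
  rw [← hbd] at h1
  have hF : 0 ≤ F ν x := le_trans (by positivity) h1
  have h2 : 1 + n * (b * x ^ 2) ≤ (F ν x) ^ n :=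
    (one_add_mul_self_le_rpow_one_add (by have : 0 ≤ b * x ^ 2 := by positivity
                                          linarith) hn).trans
      (Real.rpow_le_rpow (by positivity) h1 (by linarith))
  rw [Real.mul_rpow (Real.exp_pos _).le hF, ← Real.exp_mul, show -x * n = -(n * x) by ring]
  nlinarith [Real.exp_pos (-(n * x))]

lemma exp_aux {y : ℝ} (hy : 0 ≤ y) : Real.exp y ≤ 1 + y + y ^ 2 * Real.exp y := by
  have h1 := Real.add_one_le_exp (-y)
  have h2 : Real.exp y * Real.exp (-y) = 1 := by rw [← Real.exp_add]; simp
  have h3 := Real.exp_pos y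
  have h4 : Real.exp y - 1 ≤ y * Real.exp y := by nlinarith
  nlinarith

lemma upper (hν : -1/2 < ν) {n : ℝ} (hn : 1 ≤ n) {x : ℝ} (hx : 0 < x) :
    (Real.exp (-x) * F ν x) ^ n ≤
    Real.exp (-(n * x)) + n * (1 / (4 * (1 + ν))) * (x ^ 2 * Real.exp (-(n * x))) +
      (n * (1 / (4 * (1 + ν)))) ^ 2 * (x ^ 4 * Real.exp (-(n / 2 * x))) +
      Set.indicator (Set.Ioi (2 * (1 + ν))) (fun x => x ^ (-(δ ν * n))) x := by
  have hν1 : 0 < 1 + ν := by linarith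
  have hb : 0 < 1 / (4 * (1 + ν)) := by positivity
  have hF : 0 ≤ F ν x := le_trans (by positivity) (le_F hν x)
  have hn0 : 0 < n := by linarith
  by_cases hxe : x ∈ Set.Ioi (2 * (1 + ν))
  · rw [Set.indicator_of_mem hxe]
    have h1 : Real.exp (-x) * F ν x ≤ x ^ (-δ ν) := by
      calc _ ≤ Real.exp (-x) * (Real.exp x * x ^ (-δ ν)) := by
            gcongr; exact F_le_decay hν hx
        _ = _ := by rw [← mul_assoc, ← Real.exp_add]; simp
    have h2 := Real.rpow_le_rpow (by positivity) h1 hn0.le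
    rw [← Real.rpow_mul hx.le, neg_mul] at h2
    have : 0 ≤ Real.exp (-(n * x)) + n * (1 / (4 * (1 + ν))) * (x ^ 2 * Real.exp (-(n * x))) +
      (n * (1 / (4 * (1 + ν)))) ^ 2 * (x ^ 4 * Real.exp (-(n / 2 * x))) := by positivity
    linarith
  · rw [Set.indicator_of_notMem hxe, add_zero]
    have hxe' : x ≤ 2 * (1 + ν) := by simpa using hxe
    have hbx : 1 / (4 * (1 + ν)) * x ≤ 1 / 2 := by
      rw [one_div_mul_eq_div, div_le_iff₀ (by positivity)]; linarith
    have h1 := F_le_exp hν x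
    set b := 1 / (4 * (1 + ν)) with hbd
    set y := n * b * x ^ 2 with hy
    have hy0 : 0 ≤ y := by positivity
    have h2 : (F ν x) ^ n ≤ Real.exp y := by
      refine (Real.rpow_le_rpow hF h1 hn0.le).trans (le_of_eq ?_)
      rw [← Real.exp_mul, hy]; ring_nf
    rw [Real.mul_rpow (Real.exp_pos _).le hF, ← Real.exp_mul, show -x * n = -(n * x) by ring]
    have h3 : Real.exp (-(n * x)) * Real.exp y ≤ Real.exp (-(n / 2 * x)) := by
      rw [← Real.exp_add]
      apply Real.exp_le_exp.2
      have : y ≤ n * x * (1 / 2) := by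
        rw [hy, show n * b * x ^ 2 = n * x * (b * x) by ring]
        gcongr
      linarith
    calc Real.exp (-(n * x)) * (F ν x) ^ n
        ≤ Real.exp (-(n * x)) * (1 + y + y ^ 2 * Real.exp y) := by
          gcongr; exact h2.trans (exp_aux hy0)
      _ = Real.exp (-(n * x)) + n * b * (x ^ 2 * Real.exp (-(n * x))) +
          y ^ 2 * (Real.exp (-(n * x)) * Real.exp y) := by rw [hy]; ring
      _ ≤ Real.exp (-(n * x)) + n * b * (x ^ 2 * Real.exp (-(n * x))) +
          y ^ 2 * Real.exp (-(n / 2 * x)) := by gcongr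
      _ = _ := by rw [hy]; ring

open MeasureTheory in
lemma bounds (hν : -1/2 < ν) {n : ℝ} (hn : 1 ≤ n) (hn2 : 2 ≤ δ ν * n) :
    1 / n + 1 / (2 * (1 + ν) * n ^ 2) ≤
      (∫ x in Set.Ioi (0 : ℝ), (Real.exp (-x) * F ν x) ^ n) ∧
    (∫ x in Set.Ioi (0 : ℝ), (Real.exp (-x) * F ν x) ^ n) ≤
      1 / n + 1 / (2 * (1 + ν) * n ^ 2) + (n * (1 / (4 * (1 + ν)))) ^ 2 * (24 / (n / 2) ^ 5) +
        (2 * (1 + ν)) ^ (1 - δ ν * n) := by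
  have hν1 : 0 < 1 + ν := by linarith
  have hn0 : 0 < n := by linarith
  obtain ⟨i0, v0⟩ := int_pow_exp 0 hn0
  obtain ⟨i2, v2⟩ := int_pow_exp 2 hn0
  obtain ⟨i4, v4⟩ := int_pow_exp 4 (half_pos hn0)
  simp only [pow_zero, one_mul] at i0 v0
  have hlt : -(δ ν * n) < -1 := by linarith
  have he : 0 < 2 * (1 + ν) := by positivity
  have i5' := integrableOn_Ioi_rpow_of_lt hlt he
  have v5' := integral_Ioi_rpow_of_lt hlt he
  have i5 : IntegrableOn (Set.indicator (Set.Ioi (2 * (1 + ν))) (fun x => x ^ (-(δ ν * n))))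
      (Set.Ioi 0) := (i5'.integrable_indicator measurableSet_Ioi).integrableOn
  have v5 : ∫ x in Set.Ioi (0 : ℝ),
      Set.indicator (Set.Ioi (2 * (1 + ν))) (fun x => x ^ (-(δ ν * n))) x ≤
      (2 * (1 + ν)) ^ (1 - δ ν * n) := by
    rw [setIntegral_indicator measurableSet_Ioi, Set.Ioi_inter_Ioi, sup_eq_right.2 he.le, v5',
      show -(δ ν * n) + 1 = -(δ ν * n - 1) by ring, neg_div_neg_eq,
      show -(δ ν * n - 1) = 1 - δ ν * n by ring]
    exact div_le_self (by positivity) (by linarith)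
  have il := i0.add (i2.const_mul (n * (1 / (4 * (1 + ν)))))
  have il4 := il.add (i4.const_mul ((n * (1 / (4 * (1 + ν)))) ^ 2))
  have iu := il4.add i5
  have vl : ∫ x in Set.Ioi (0 : ℝ), (Real.exp (-(n * x)) +
      n * (1 / (4 * (1 + ν))) * (x ^ 2 * Real.exp (-(n * x)))) =
      1 / n + 1 / (2 * (1 + ν) * n ^ 2) := by
    rw [integral_add i0 (i2.const_mul _), integral_const_mul, v0, v2]
    norm_num [Nat.factorial]
    field_simp
    norm_num
  have iI : IntegrableOn (fun x => (Real.exp (-x) * F ν x) ^ n) (Set.Ioi 0) := by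
    refine Integrable.mono' iu ?_ ?_
    · have := measurable_F hν
      exact Measurable.aestronglyMeasurable (by fun_prop)
    · refine (ae_restrict_iff' measurableSet_Ioi).2 (ae_of_all _ fun x hx => ?_)
      have hF : 0 ≤ F ν x := le_trans (by positivity) (le_F hν x)
      rw [Real.norm_of_nonneg (by positivity)]
      exact upper hν hn hx
  constructor
  · rw [← vl]
    exact setIntegral_mono_on il iI measurableSet_Ioi fun x _ => lower hν hn x
  · refine (setIntegral_mono_on iI iu measurableSet_Ioi fun x hx => upper hν hn hx).trans ?_
    have e1 := integral_add il4 i5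
    have e2 := integral_add il (i4.const_mul ((n * (1 / (4 * (1 + ν)))) ^ 2))
    simp only [Pi.add_apply] at e1 e2
    rw [integral_const_mul, v4] at e2
    simp only [Pi.add_apply]
    rw [e1, e2, vl]
    norm_num [Nat.factorial] at v5 ⊢
    linarith

end BallBessel

open BallBessel in
theorem ball_besselI_asymptotics {ν : ℝ} (hν : -1/2 < ν) :
    (fun n : ℝ =>
        (∫ x in Set.Ioi (0 : ℝ),
            (Real.exp (-x) * Real.Gamma (1 + ν) * besselI ν x / (x / 2) ^ ν) ^ n) -
          (1 / n + 1 / (2 * (1 + ν) * n ^ 2)))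
      =O[atTop] fun n : ℝ => 1 / n ^ 3 := by
  have hν1 : 0 < 1 + ν := by linarith
  have he : 1 < 2 * (1 + ν) := by linarith
  have hl := Real.log_pos he
  have hδ := δ_pos hν
  set L := δ ν * Real.log (2 * (1 + ν)) with hL
  have hL0 : 0 < L := by positivity
  refine IsBigO.of_bound ((1 / (4 * (1 + ν))) ^ 2 * 24 * 32 + 2 * (1 + ν) * (6 / L ^ 3)) ?_
  filter_upwards [eventually_ge_atTop 1, eventually_ge_atTop (2 / δ ν)] with n hn hn2
  have hn0 : 0 < n := by linarith
  have hn2' : 2 ≤ δ ν * n := by rw [div_le_iff₀ hδ] at hn2; linarith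
  have hI : (∫ x in Set.Ioi (0 : ℝ),
      (Real.exp (-x) * Real.Gamma (1 + ν) * besselI ν x / (x / 2) ^ ν) ^ n) =
      ∫ x in Set.Ioi (0 : ℝ), (Real.exp (-x) * F ν x) ^ n := by
    refine MeasureTheory.setIntegral_congr_fun measurableSet_Ioi fun x hx => ?_
    simp only [integrand_eq hx]
  rw [hI]
  obtain ⟨hlo, hup⟩ := bounds hν hn hn2'
  rw [Real.norm_of_nonneg (by linarith), Real.norm_of_nonneg (by positivity)]
  have ht : (2 * (1 + ν)) ^ (1 - δ ν * n) ≤ 2 * (1 + ν) * (6 / L ^ 3) * (1 / n ^ 3) := by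
    rw [Real.rpow_sub (by positivity), Real.rpow_one, Real.rpow_def_of_pos (by positivity),
      show Real.log (2 * (1 + ν)) * (δ ν * n) = L * n by rw [hL]; ring]
    have h := Real.pow_div_factorial_le_exp (x := L * n) (by positivity) 3
    norm_num [Nat.factorial] at h
    calc 2 * (1 + ν) / Real.exp (L * n) ≤ 2 * (1 + ν) / ((L * n) ^ 3 / 6) := by gcongr
      _ = _ := by field_simp
  have e : (n * (1 / (4 * (1 + ν)))) ^ 2 * (24 / (n / 2) ^ 5) =
      (1 / (4 * (1 + ν))) ^ 2 * 24 * 32 * (1 / n ^ 3) := by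
    field_simp
    norm_num
  rw [e] at hup
  rw [add_mul]
  linarith
end

section
/- For ν ≥ 0, as n → ∞, Î_n = ∫_0^∞ (Γ(1+ν) I_ν(x)/(x/2)^ν)^{-n} dx satisfies Î_n = (1+ν)^{1/2} √(π/n) (1 + O(1/n)); more precisely Î_n ~ (1+ν)^{1/2} [Γ(1/2)/n^{1/2} + (3/(4(2+ν))) Γ(3/2)/n^{3/2} + O(n^{-5/2})]. -/
open Real Filter Asymptotics

/-- Normalised coefficients. -/
noncomputable def bpc (ν : ℝ) (k : ℕ) : ℝ :=
  Real.Gamma (1 + ν) / Real.Gamma (ν + k + 1) * (1 + ν) ^ k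

/-- The normalised Bessel function in the variable t = x^2/(4(1+ν)). -/
noncomputable def bF (ν t : ℝ) : ℝ := ∑' k : ℕ, bpc ν k * (t ^ k / k.factorial)

lemma bpc_zero {ν : ℝ} (hν : 0 ≤ ν) : bpc ν 0 = 1 := by
  have : Real.Gamma (1 + ν) ≠ 0 := (Real.Gamma_pos_of_pos (by linarith)).ne'
  simp [bpc, add_comm ν 1, this]

lemma bpc_succ {ν : ℝ} (hν : 0 ≤ ν) (k : ℕ) :
    bpc ν (k + 1) = bpc ν k * ((1 + ν) / (1 + ν + k)) := by
  have h1 : (0 : ℝ) < ν + k + 1 := by positivity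
  have h0 : Real.Gamma (ν + k + 1) ≠ 0 := (Real.Gamma_pos_of_pos h1).ne'
  have h2 : Real.Gamma (ν + (k + 1 : ℕ) + 1) = (ν + k + 1) * Real.Gamma (ν + k + 1) := by
    rw [← Real.Gamma_add_one h1.ne']
    push_cast
    congr 1
    ring
  have h3 : 1 + ν + k ≠ 0 := by positivity
  have h4 : ν + k + 1 ≠ 0 := h1.ne'
  unfold bpc
  rw [h2, pow_succ, show 1 + ν + (k : ℝ) = ν + k + 1 by ring]
  field_simp

lemma bpc_nonneg {ν : ℝ} (hν : 0 ≤ ν) (k : ℕ) : 0 ≤ bpc ν k := by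
  induction k with
  | zero => rw [bpc_zero hν]; norm_num
  | succ k ih => rw [bpc_succ hν]; positivity

lemma bpc_le_one {ν : ℝ} (hν : 0 ≤ ν) (k : ℕ) : bpc ν k ≤ 1 := by
  induction k with
  | zero => rw [bpc_zero hν]
  | succ k ih =>
    rw [bpc_succ hν]
    refine mul_le_one₀ ih (by positivity) ?_
    rw [div_le_one (by positivity)]
    have : (0 : ℝ) ≤ k := by positivity
    linarith

lemma bpc_one {ν : ℝ} (hν : 0 ≤ ν) : bpc ν 1 = 1 := by
  have := bpc_succ hν 0
  rw [bpc_zero hν] at this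
  rw [this]
  have : 1 + ν ≠ 0 := by positivity
  field_simp
  simp

lemma bpc_two {ν : ℝ} (hν : 0 ≤ ν) : bpc ν 2 = (1 + ν) / (2 + ν) := by
  have := bpc_succ hν 1
  rw [bpc_one hν] at this
  rw [this]
  push_cast
  rw [one_mul, show 1 + ν + 1 = 2 + ν by ring]

lemma bF_summable {ν t : ℝ} (hν : 0 ≤ ν) (ht : 0 ≤ t) :
    Summable (fun k : ℕ => bpc ν k * (t ^ k / k.factorial)) := by
  refine Summable.of_nonneg_of_le (fun k => ?_) (fun k => ?_) (Real.summable_pow_div_factorial t)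
  · have := bpc_nonneg hν k
    positivity
  · exact mul_le_of_le_one_left (by positivity) (bpc_le_one hν k)

lemma bF_split {ν t : ℝ} (hν : 0 ≤ ν) (ht : 0 ≤ t) :
    bF ν t = 1 + t + (1 + ν) / (2 * (2 + ν)) * t ^ 2 +
      ∑' k : ℕ, bpc ν (k + 3) * (t ^ (k + 3) / (k + 3).factorial) := by
  unfold bF
  rw [← (bF_summable hν ht).sum_add_tsum_nat_add 3]
  simp [Finset.sum_range_succ, bpc_zero hν, bpc_one hν, bpc_two hν, Nat.factorial]
  have : 2 + ν ≠ 0 := by positivity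
  field_simp

lemma bF_le_exp {ν t : ℝ} (hν : 0 ≤ ν) (ht : 0 ≤ t) : bF ν t ≤ exp t := by
  rw [Real.exp_eq_exp_ℝ, NormedSpace.exp_eq_tsum_div]
  refine Summable.tsum_le_tsum (fun k => ?_) (bF_summable hν ht)
    (Real.summable_pow_div_factorial t)
  exact mul_le_of_le_one_left (by positivity) (bpc_le_one hν k)

lemma bF_ge {ν t : ℝ} (hν : 0 ≤ ν) (ht : 0 ≤ t) :
    1 + t + (1 + ν) / (2 * (2 + ν)) * t ^ 2 ≤ bF ν t := by
  rw [bF_split hν ht]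
  have : 0 ≤ ∑' k : ℕ, bpc ν (k + 3) * (t ^ (k + 3) / (k + 3).factorial) :=
    tsum_nonneg fun k => mul_nonneg (bpc_nonneg hν _) (by positivity)
  linarith

lemma bF_le {ν t : ℝ} (hν : 0 ≤ ν) (ht : 0 ≤ t) (ht1 : t ≤ 1) :
    bF ν t ≤ 1 + t + (1 + ν) / (2 * (2 + ν)) * t ^ 2 + 3 * t ^ 3 := by
  rw [bF_split hν ht]
  have hs : Summable (fun k : ℕ => t ^ 3 * (t ^ k / k.factorial)) :=
    (Real.summable_pow_div_factorial t).mul_left _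
  have h1 : ∑' k : ℕ, bpc ν (k + 3) * (t ^ (k + 3) / (k + 3).factorial) ≤
      ∑' k : ℕ, t ^ 3 * (t ^ k / k.factorial) := by
    refine Summable.tsum_le_tsum (fun k => ?_)
      ((summable_nat_add_iff 3).2 (bF_summable hν ht)) hs
    refine (mul_le_of_le_one_left (by positivity) (bpc_le_one hν _)).trans ?_
    rw [pow_add, mul_comm (t ^ k), mul_div_assoc]
    gcongr
    exact Nat.le_add_right k 3
  have he : exp t = ∑' k : ℕ, t ^ k / k.factorial := by
    rw [Real.exp_eq_exp_ℝ, NormedSpace.exp_eq_tsum_div]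
  rw [tsum_mul_left, ← he] at h1
  have h2 : exp t ≤ 3 := (exp_le_exp.2 ht1).trans (by have := Real.exp_one_lt_d9; linarith)
  have h3 : 0 ≤ t ^ 3 := by positivity
  nlinarith

lemma bF_mono {ν : ℝ} (hν : 0 ≤ ν) : MonotoneOn (bF ν) (Set.Ici 0) := by
  intro s hs t ht hst
  have hs : 0 ≤ s := hs
  refine Summable.tsum_le_tsum (fun k => ?_) (bF_summable hν hs) (bF_summable hν ht)
  have := bpc_nonneg hν k
  gcongr

lemma bessel_eq {ν x : ℝ} (hν : 0 ≤ ν) (hx : 0 < x) :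
    Real.Gamma (1 + ν) * besselI ν x / (x / 2) ^ ν = bF ν (x ^ 2 / (4 * (1 + ν))) := by
  unfold besselI bF
  rw [← tsum_mul_left, ← tsum_div_const]
  congr 1
  ext k
  have hx2 : 0 < x / 2 := by positivity
  have h1 : (0 : ℝ) < ν + k + 1 := by positivity
  have h0 : Real.Gamma (ν + k + 1) ≠ 0 := (Real.Gamma_pos_of_pos h1).ne'
  have h3 : (x / 2) ^ ν ≠ 0 := (Real.rpow_pos_of_pos hx2 _).ne'
  have h4 : (x / 2) ^ (2 * (k : ℝ)) = (x ^ 2 / 4) ^ k := by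
    rw [Real.rpow_mul hx2.le, Real.rpow_natCast]
    congr 1
    norm_cast
    ring
  have ha : 1 + ν ≠ 0 := by positivity
  rw [Real.rpow_add hx2, h4, bpc, show x ^ 2 / (4 * (1 + ν)) = (x ^ 2 / 4) / (1 + ν) by field_simp,
    div_pow (x ^ 2 / 4)]
  field_simp

lemma log_ge_aux {z : ℝ} (hz : 0 ≤ z) : z - z ^ 2 / 2 ≤ log (1 + z) := by
  refine le_trans ?_ (Real.le_log_one_add_of_nonneg hz)
  rw [le_div_iff₀ (by linarith)]
  have : 0 ≤ z ^ 3 := by positivity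
  nlinarith

lemma bF_pos {ν t : ℝ} (hν : 0 ≤ ν) (ht : 0 ≤ t) : 1 + t ≤ bF ν t := by
  refine le_trans ?_ (bF_ge hν ht)
  have : 0 ≤ (1 + ν) / (2 * (2 + ν)) * t ^ 2 := by positivity
  linarith

lemma d_nonneg {ν t : ℝ} (hν : 0 ≤ ν) (ht : 0 ≤ t) : 0 ≤ t - log (bF ν t) := by
  have h := bF_pos hν ht
  have := Real.log_le_log (by linarith) (bF_le_exp hν ht)
  rw [Real.log_exp] at this
  linarith

lemma d_le_sq {ν t : ℝ} (hν : 0 ≤ ν) (ht : 0 ≤ t) : t - log (bF ν t) ≤ t ^ 2 / 2 := by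
  have h := Real.log_le_log (by linarith) (bF_pos hν ht)
  have := log_ge_aux ht
  linarith

lemma d_taylor {ν t : ℝ} (hν : 0 ≤ ν) (ht : 0 ≤ t) :
    |t - log (bF ν t) - 1 / (2 * (2 + ν)) * t ^ 2| ≤ 4 * t ^ 3 := by
  set c := 1 / (2 * (2 + ν)) with hc
  have hcpos : 0 < c := by positivity
  have hc4 : c ≤ 1 / 4 := by
    rw [hc]
    gcongr
    linarith
  have hβ : (1 + ν) / (2 * (2 + ν)) = 1 / 2 - c := by
    rw [hc]
    field_simp
    ring
  have hd := d_nonneg hν ht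
  have hF := bF_pos hν ht
  rcases le_total t 1 with h1 | h1
  · rw [abs_le]
    constructor
    · have hle := bF_le hν ht h1
      rw [hβ] at hle
      have hw : 0 ≤ t - c * t ^ 2 := by nlinarith [mul_nonneg ht (sub_nonneg.2 h1)]
      have ht3 : 0 ≤ t ^ 3 := by positivity
      have hq := Real.quadratic_le_exp_of_nonneg (show 0 ≤ t - c * t ^ 2 + 4 * t ^ 3 by linarith)
      have hsq : (t - c * t ^ 2) ^ 2 ≤ (t - c * t ^ 2 + 4 * t ^ 3) ^ 2 := by
        gcongr
        linarith
      have hsq2 : t ^ 2 - 2 * c * t ^ 3 ≤ (t - c * t ^ 2) ^ 2 := by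
        have : 0 ≤ c ^ 2 * t ^ 4 := by positivity
        nlinarith
      have hfin : bF ν t ≤ exp (t - c * t ^ 2 + 4 * t ^ 3) := by
        refine hle.trans (le_trans ?_ hq)
        nlinarith
      have := Real.log_le_log (by linarith) hfin
      rw [Real.log_exp] at this
      linarith
    · have hge := bF_ge hν ht
      rw [hβ] at hge
      have hz : 0 ≤ t + (1 / 2 - c) * t ^ 2 := by
        have : 0 ≤ (1 / 2 - c) * t ^ 2 := mul_nonneg (by linarith) (by positivity)
        linarith
      have hl := log_ge_aux hz
      have hm := Real.log_le_log (by linarith) (show 1 + (t + (1 / 2 - c) * t ^ 2) ≤ bF ν t by linarith)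
      have ht3 : 0 ≤ t ^ 3 := by positivity
      have ht4 : t ^ 4 ≤ t ^ 3 := pow_le_pow_of_le_one ht h1 (by norm_num)
      have ht40 : 0 ≤ t ^ 4 := by positivity
      have e1 : (t + (1 / 2 - c) * t ^ 2) ^ 2 = t ^ 2 + 2 * (1 / 2 - c) * t ^ 3 +
        (1 / 2 - c) ^ 2 * t ^ 4 := by ring
      have e2 : (1 / 2 - c) ^ 2 * t ^ 4 ≤ 1 * t ^ 4 := by
        gcongr
        nlinarith
      nlinarith
  · have hh : 0 ≤ log (bF ν t) := Real.log_nonneg (by linarith)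
    have a1 : t ≤ t ^ 3 := le_self_pow₀ h1 (by norm_num)
    have a2 : t ^ 2 ≤ t ^ 3 := pow_le_pow_right₀ h1 (by norm_num)
    have a3 : 0 ≤ c * t ^ 2 := by positivity
    have a4 : c * t ^ 2 ≤ t ^ 2 := mul_le_of_le_one_left (by positivity) (by linarith)
    rw [abs_le]
    constructor <;> linarith

lemma exp_aux {w : ℝ} (hw : 0 ≤ w) : 0 ≤ exp w - 1 - w ∧ exp w - 1 - w ≤ w ^ 2 * exp w := by
  have h1 := Real.add_one_le_exp w
  have h2 : exp w - 1 ≤ w * exp w := by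
    have h3 := Real.add_one_le_exp (-w)
    have h4 : exp w * exp (-w) = 1 := by rw [← Real.exp_add]; simp
    nlinarith [Real.exp_pos w]
  exact ⟨by linarith, by nlinarith⟩

lemma one_add_pow_aux {n t : ℝ} (hn : 5 ≤ n) (ht : 0 ≤ t) :
    (1 + n * t / 5) ^ 5 ≤ (1 + t) ^ n := by
  have h := one_add_mul_self_le_rpow_one_add (show -1 ≤ t by linarith) (show 1 ≤ n / 5 by linarith)
  calc (1 + n * t / 5) ^ 5 = (1 + n / 5 * t) ^ 5 := by ring
    _ ≤ ((1 + t) ^ (n / 5)) ^ 5 := by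
      have : 0 ≤ n / 5 * t := by positivity
      gcongr
    _ = (1 + t) ^ n := by
      rw [← Real.rpow_natCast, ← Real.rpow_mul (by linarith)]
      congr 1
      push_cast
      ring

lemma bF_rpow_le {ν n t : ℝ} (hν : 0 ≤ ν) (hn : 5 ≤ n) (ht : 0 ≤ t) :
    (bF ν t) ^ (-n) ≤ ((1 + n * t / 5) ^ 5)⁻¹ := by
  rw [Real.rpow_neg (by linarith [bF_pos hν ht])]
  have : 0 ≤ n * t / 5 := by positivity
  refine inv_anti₀ (by positivity) ((one_add_pow_aux hn ht).trans ?_)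
  exact Real.rpow_le_rpow (by linarith) (bF_pos hν ht) (by linarith)

lemma pointwise {ν n t : ℝ} (hν : 0 ≤ ν) (hn : 5 ≤ n) (ht : 0 ≤ t) :
    |(bF ν t) ^ (-n) - exp (-(n * t)) * (1 + n * (1 / (2 * (2 + ν)) * t ^ 2))| ≤
      700 / n ^ 2 * (1 + n * t / 5)⁻¹ := by
  have hF := bF_pos hν ht
  have hn0 : 0 < n := by linarith
  set c := 1 / (2 * (2 + ν)) with hc
  set d := t - log (bF ν t) with hd
  have hd0 : 0 ≤ d := d_nonneg hν ht
  have hd2 : d ≤ t ^ 2 / 2 := d_le_sq hν ht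
  have hd3 : |d - c * t ^ 2| ≤ 4 * t ^ 3 := d_taylor hν ht
  have e1 : (bF ν t) ^ (-n) = exp (-(n * t)) * exp (n * d) := by
    rw [Real.rpow_def_of_pos (by linarith), ← Real.exp_add]
    congr 1
    rw [hd]
    ring
  set z := 1 + n * t / 5 with hz
  have hz1 : 1 ≤ z := by
    have : 0 ≤ n * t / 5 := by positivity
    linarith
  have hB : (bF ν t) ^ (-n) ≤ (z ^ 5)⁻¹ := bF_rpow_le hν hn ht
  have hE : exp (-(n * t)) ≤ (z ^ 5)⁻¹ := by
    rw [Real.exp_neg]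
    refine inv_anti₀ (by positivity) ?_
    calc z ^ 5 ≤ (exp (n * t / 5)) ^ 5 := by
          have := Real.add_one_le_exp (n * t / 5)
          gcongr
          linarith
      _ = exp (n * t) := by
          rw [← Real.exp_nat_mul]
          congr 1
          push_cast
          ring
  obtain ⟨w0, w1⟩ := exp_aux (show 0 ≤ n * d by positivity)
  have hs : n * t ≤ 5 * z := by rw [hz]; linarith
  have hs0 : 0 ≤ n * t := by positivity
  have t1 : exp (-(n * t)) * (n * |d - c * t ^ 2|) ≤ 500 / n ^ 2 * z⁻¹ := by
    calc exp (-(n * t)) * (n * |d - c * t ^ 2|) ≤ (z ^ 5)⁻¹ * (n * (4 * t ^ 3)) := by gcongr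
      _ = (z ^ 5)⁻¹ * (4 * (n * t) ^ 3 / n ^ 2) := by field_simp
      _ ≤ (z ^ 5)⁻¹ * (4 * (5 * z) ^ 3 / n ^ 2) := by gcongr
      _ = 500 / n ^ 2 * (z ^ 2)⁻¹ := by field_simp; ring
      _ ≤ 500 / n ^ 2 * z⁻¹ := by
          gcongr
          exact le_self_pow₀ hz1 (by norm_num)
  have t2 : exp (-(n * t)) * (exp (n * d) - 1 - n * d) ≤ 200 / n ^ 2 * z⁻¹ := by
    calc exp (-(n * t)) * (exp (n * d) - 1 - n * d)
        ≤ exp (-(n * t)) * ((n * d) ^ 2 * exp (n * d)) := by gcongr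
      _ = (n * d) ^ 2 * (bF ν t) ^ (-n) := by rw [e1]; ring
      _ ≤ (n * (t ^ 2 / 2)) ^ 2 * (z ^ 5)⁻¹ := by
          have hpos : 0 ≤ bF ν t ^ (-n) := Real.rpow_nonneg (by linarith) _
          gcongr
      _ = (n * t) ^ 4 / (4 * n ^ 2) * (z ^ 5)⁻¹ := by field_simp; ring
      _ ≤ (5 * z) ^ 4 / (4 * n ^ 2) * (z ^ 5)⁻¹ := by gcongr
      _ = (625 / 4) / n ^ 2 * z⁻¹ := by field_simp; ring
      _ ≤ 200 / n ^ 2 * z⁻¹ := by gcongr; norm_num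
  have e2 : (bF ν t) ^ (-n) - exp (-(n * t)) * (1 + n * (c * t ^ 2)) =
      exp (-(n * t)) * (n * (d - c * t ^ 2)) + exp (-(n * t)) * (exp (n * d) - 1 - n * d) := by
    rw [e1]; ring
  rw [e2]
  refine (abs_add_le _ _).trans ?_
  rw [abs_mul, abs_mul, abs_mul, abs_of_pos (Real.exp_pos _), abs_of_pos hn0, abs_of_nonneg w0]
  calc _ ≤ 500 / n ^ 2 * z⁻¹ + 200 / n ^ 2 * z⁻¹ := add_le_add t1 t2
    _ = _ := by ring


lemma gauss_q {b : ℝ} (hb : 0 < b) (m : ℕ) :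
    MeasureTheory.IntegrableOn (fun x : ℝ => x ^ m * exp (-(b * x ^ 2))) (Set.Ioi 0) ∧
    ∫ x in Set.Ioi (0 : ℝ), x ^ m * exp (-(b * x ^ 2)) =
      b ^ (-((m : ℝ) + 1) / 2) * (1 / 2) * Real.Gamma (((m : ℝ) + 1) / 2) := by
  have hm : (-1 : ℝ) < m := by have : (0 : ℝ) ≤ m := by positivity
                               linarith
  constructor
  · have := integrableOn_rpow_mul_exp_neg_mul_sq hb hm
    simpa using this
  · have := integral_rpow_mul_exp_neg_mul_rpow (p := 2) (q := m) (b := b) (by norm_num) hm hb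
    simpa using this

lemma main_integral {ν n : ℝ} (hν : 0 ≤ ν) (hn : 0 < n) :
    MeasureTheory.IntegrableOn (fun x : ℝ => exp (-(n * (x ^ 2 / (4 * (1 + ν))))) *
      (1 + n * (1 / (2 * (2 + ν)) * (x ^ 2 / (4 * (1 + ν))) ^ 2))) (Set.Ioi 0) ∧
    ∫ x in Set.Ioi (0 : ℝ), exp (-(n * (x ^ 2 / (4 * (1 + ν))))) *
      (1 + n * (1 / (2 * (2 + ν)) * (x ^ 2 / (4 * (1 + ν))) ^ 2)) =
      (1 + ν) ^ ((1 : ℝ)/2) *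
            (Real.Gamma (1/2) / n ^ ((1 : ℝ)/2) +
              3 / (4 * (2 + ν)) * Real.Gamma (3/2) / n ^ ((3 : ℝ)/2)) := by
  have ha : 0 < 1 + ν := by linarith
  set a := 1 + ν with hadef
  have hb : 0 < n / (4 * a) := by positivity
  obtain ⟨i0, v0⟩ := gauss_q hb 0
  obtain ⟨i4, v4⟩ := gauss_q hb 4
  set κ := n / (2 * (2 + ν) * (16 * a ^ 2)) with hκ
  have e : (fun x : ℝ => exp (-(n * (x ^ 2 / (4 * a)))) *
      (1 + n * (1 / (2 * (2 + ν)) * (x ^ 2 / (4 * a)) ^ 2))) =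
      fun x => x ^ 0 * exp (-(n / (4 * a) * x ^ 2)) +
        κ * (x ^ 4 * exp (-(n / (4 * a) * x ^ 2))) := by
    ext x
    rw [show n * (x ^ 2 / (4 * a)) = n / (4 * a) * x ^ 2 by ring, hκ]
    field_simp
    ring
  rw [e]
  refine ⟨i0.add (i4.const_mul κ), ?_⟩
  rw [MeasureTheory.integral_add i0 (i4.const_mul κ), MeasureTheory.integral_const_mul, v0, v4]
  have g1 : Real.Gamma (3 / 2) = 1 / 2 * Real.Gamma (1 / 2) := by
    rw [← Real.Gamma_add_one (by norm_num)]; norm_num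
  have g2 : Real.Gamma (5 / 2) = 3 / 2 * Real.Gamma (3 / 2) := by
    rw [← Real.Gamma_add_one (by norm_num)]; norm_num
  have h4 : (4 : ℝ) ^ ((1 : ℝ) / 2) = 2 := by
    rw [← Real.sqrt_eq_rpow, show (4 : ℝ) = 2 ^ 2 by norm_num]
    exact Real.sqrt_sq (by norm_num)
  have b1 : (n / (4 * a)) ^ (-((0 : ℕ) + 1 : ℝ) / 2) = 2 * a ^ ((1 : ℝ) / 2) / n ^ ((1 : ℝ) / 2) := by
    rw [show (-((0 : ℕ) + 1 : ℝ) / 2) = -(1 / 2) by norm_num, Real.rpow_neg hb.le,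
      Real.div_rpow hn.le (by positivity), Real.mul_rpow (by norm_num) ha.le, h4, inv_div]
  have b5 : (n / (4 * a)) ^ (-((4 : ℕ) + 1 : ℝ) / 2) =
      2 * a ^ ((1 : ℝ) / 2) / n ^ ((1 : ℝ) / 2) * (16 * a ^ 2 / n ^ 2) := by
    rw [← b1, show (-((4 : ℕ) + 1 : ℝ) / 2) = -((0 : ℕ) + 1 : ℝ) / 2 + (-(2 : ℕ) : ℝ) by norm_num,
      Real.rpow_add hb, Real.rpow_neg hb.le ((2 : ℕ) : ℝ), Real.rpow_natCast]
    congr 1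
    field_simp
    norm_num
  have n3 : n ^ ((3 : ℝ) / 2) = n ^ ((1 : ℝ) / 2) * n := by
    rw [show (3 : ℝ) / 2 = 1 / 2 + 1 by norm_num, Real.rpow_add hn, Real.rpow_one]
  have hnn : n ^ ((1 : ℝ) / 2) ≠ 0 := (Real.rpow_pos_of_pos hn _).ne'
  rw [b1, b5, n3, show (((0 : ℕ) : ℝ) + 1) / 2 = 1 / 2 by norm_num,
    show (((4 : ℕ) : ℝ) + 1) / 2 = 5 / 2 by norm_num, g2, g1, hκ]
  have : 2 + ν ≠ 0 := by positivity
  field_simp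
  ring

lemma bound_integral {k : ℝ} (hk : 0 < k) :
    MeasureTheory.IntegrableOn (fun x : ℝ => (1 + k * x ^ 2)⁻¹) (Set.Ioi 0) ∧
    ∫ x in Set.Ioi (0 : ℝ), (1 + k * x ^ 2)⁻¹ = (√k)⁻¹ * (π / 2) := by
  have hs : 0 < √k := Real.sqrt_pos.2 hk
  have e : (fun x : ℝ => (1 + k * x ^ 2)⁻¹) = fun x => (fun y : ℝ => (1 + y ^ 2)⁻¹) (√k * x) := by
    ext x
    simp only [mul_pow, Real.sq_sqrt hk.le]
  constructor
  · rw [e]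
    exact (integrable_inv_one_add_sq.comp_mul_left' hs.ne').integrableOn
  · rw [e, MeasureTheory.integral_comp_mul_left_Ioi (fun y : ℝ => (1 + y ^ 2)⁻¹) 0 hs, mul_zero,
      integral_Ioi_inv_one_add_sq]
    simp

theorem ball_besselI_inverse_asymptotics {ν : ℝ} (hν : 0 ≤ ν) :
    (fun n : ℝ =>
        (∫ x in Set.Ioi (0 : ℝ),
            (Real.Gamma (1 + ν) * besselI ν x / (x / 2) ^ ν) ^ (-n)) -
          (1 + ν) ^ ((1 : ℝ)/2) *
            (Real.Gamma (1/2) / n ^ ((1 : ℝ)/2) +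
              3 / (4 * (2 + ν)) * Real.Gamma (3/2) / n ^ ((3 : ℝ)/2)))
      =O[atTop] fun n : ℝ => n ^ (-(5 : ℝ)/2) := by
  have ha : 0 < 1 + ν := by linarith
  set k : ℝ := 1 / (20 * (1 + ν)) with hk
  have hkpos : 0 < k := by positivity
  refine Asymptotics.IsBigO.of_bound (700 * ((√k)⁻¹ * (π / 2))) ?_
  filter_upwards [eventually_ge_atTop (5 : ℝ)] with n hn
  have hn0 : 0 < n := by linarith
  obtain ⟨iG, vG⟩ := main_integral hν hn0
  obtain ⟨iB, vB⟩ := bound_integral (mul_pos hn0 hkpos)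
  have hcongr : ∫ x in Set.Ioi (0 : ℝ),
      (Real.Gamma (1 + ν) * besselI ν x / (x / 2) ^ ν) ^ (-n) =
      ∫ x in Set.Ioi (0 : ℝ), (bF ν (x ^ 2 / (4 * (1 + ν)))) ^ (-n) := by
    refine MeasureTheory.setIntegral_congr_fun measurableSet_Ioi fun x hx => ?_
    simp only [bessel_eq hν hx]
  have harg : ∀ x : ℝ, 1 + n * (x ^ 2 / (4 * (1 + ν))) / 5 = 1 + n * k * x ^ 2 := by
    intro x
    rw [hk]
    field_simp
    ring
  have hmeas : AEMeasurable (fun x : ℝ => (bF ν (x ^ 2 / (4 * (1 + ν)))) ^ (-n))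
      (MeasureTheory.volume.restrict (Set.Ioi 0)) := by
    refine aemeasurable_restrict_of_antitoneOn measurableSet_Ioi ?_
    intro x hx y hy hxy
    have hx : 0 < x := hx
    refine Real.rpow_le_rpow_of_nonpos ?_ ?_ (by linarith)
    · have := bF_pos hν (show 0 ≤ x ^ 2 / (4 * (1 + ν)) by positivity)
      have : 0 ≤ x ^ 2 / (4 * (1 + ν)) := by positivity
      linarith
    · refine bF_mono hν (Set.mem_Ici.2 (by positivity)) (Set.mem_Ici.2 (by positivity)) ?_
      gcongr
  have iF : MeasureTheory.IntegrableOn (fun x : ℝ => (bF ν (x ^ 2 / (4 * (1 + ν)))) ^ (-n))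
      (Set.Ioi 0) := by
    refine MeasureTheory.Integrable.mono' iB hmeas.aestronglyMeasurable ?_
    refine MeasureTheory.ae_of_all _ fun x => ?_
    have ht : 0 ≤ x ^ 2 / (4 * (1 + ν)) := by positivity
    have hF := bF_pos hν ht
    rw [Real.norm_of_nonneg (Real.rpow_nonneg (by linarith) _)]
    refine (bF_rpow_le hν hn ht).trans ?_
    rw [harg]
    have : 0 ≤ n * k * x ^ 2 := by positivity
    refine inv_anti₀ (by positivity) (le_self_pow₀ (by linarith) (by norm_num))
  rw [hcongr, ← vG, ← MeasureTheory.integral_sub iF iG]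
  refine (MeasureTheory.norm_integral_le_of_norm_le (iB.const_mul (700 / n ^ 2))
    (MeasureTheory.ae_of_all _ fun x => ?_)).trans ?_
  · have := pointwise hν hn (show 0 ≤ x ^ 2 / (4 * (1 + ν)) by positivity)
    rw [harg] at this
    exact this
  · rw [MeasureTheory.integral_const_mul, vB, Real.norm_of_nonneg (Real.rpow_nonneg hn0.le _),
      Real.sqrt_mul hn0.le, show -(5 : ℝ) / 2 = -(1 / 2) + -(2 : ℕ) by norm_num,
      Real.rpow_add hn0, Real.rpow_neg hn0.le, Real.rpow_neg hn0.le, Real.rpow_natCast,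
      ← Real.sqrt_eq_rpow]
    apply le_of_eq
    have : 0 < √n := Real.sqrt_pos.2 hn0
    have : 0 < √k := Real.sqrt_pos.2 hkpos
    field_simp
end

section
/- For ν > 1/2, the function ψ(x) = x + log(2(x/2)^ν K_ν(x)/Γ(ν)) is a strictly increasing bijection from [0,∞) onto [0,∞). -/
open Real

/-- Modified Bessel function of the second kind (Macdonald function), via its
integral representation for positive argument. -/
noncomputable def besselK (ν x : ℝ) : ℝ :=
  ∫ t in Set.Ioi (0 : ℝ), Real.exp (-x * Real.cosh t) * Real.cosh (ν * t)

/-- The phase function `ψ(x) = x + log(2 (x/2)^ν K_ν(x)/Γ(ν))`, extended by its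
limiting value `ψ(0) = 0` at the origin. -/
noncomputable def psiK (ν x : ℝ) : ℝ :=
  if x = 0 then 0
  else x + Real.log (2 * (x / 2) ^ ν * besselK ν x / Real.Gamma ν)

open MeasureTheory Filter Topology

lemma bk_image {c : ℝ} (hc : 0 < c) :
    (fun t : ℝ => c * Real.exp t) '' Set.univ = Set.Ioi 0 := by
  ext u
  simp only [Set.image_univ, Set.mem_range, Set.mem_Ioi]
  constructor
  · rintro ⟨t, rfl⟩
    positivity
  · intro hu
    refine ⟨Real.log (u / c), ?_⟩
    rw [Real.exp_log (by positivity)]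
    field_simp

lemma bk_pt {ν x : ℝ} (hx : 0 < x) (t : ℝ) :
    |x / 2 * Real.exp t| • (Real.exp (-(x / 2 * Real.exp t) - x ^ 2 / (4 * (x / 2 * Real.exp t)))
        * (x / 2 * Real.exp t) ^ (ν - 1))
      = (x / 2) ^ ν * (Real.exp (-x * Real.cosh t) * Real.exp (ν * t)) := by
  have h0 : 0 < x / 2 * Real.exp t := by positivity
  have h1 : -(x / 2 * Real.exp t) - x ^ 2 / (4 * (x / 2 * Real.exp t)) = -x * Real.cosh t := by
    rw [Real.cosh_eq, Real.exp_neg]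
    field_simp
    ring
  have h2 : (x / 2 * Real.exp t) * (x / 2 * Real.exp t) ^ (ν - 1)
      = (x / 2) ^ ν * Real.exp (ν * t) := by
    rw [Real.rpow_sub_one h0.ne', mul_div_cancel₀ _ h0.ne',
      Real.mul_rpow (by positivity) (by positivity), ← Real.exp_mul, mul_comm t]
  rw [abs_of_pos h0, h1, smul_eq_mul, mul_left_comm, h2]
  ring

lemma bk_bound (x : ℝ) (ν : ℝ) {u : ℝ} (hu : 0 < u) :
    ‖Real.exp (-u - x ^ 2 / (4 * u)) * u ^ (ν - 1)‖ ≤ Real.exp (-u) * u ^ (ν - 1) := by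
  rw [Real.norm_of_nonneg (by positivity)]
  gcongr
  have : 0 ≤ x ^ 2 / (4 * u) := by positivity
  linarith

lemma bk_meas (x ν : ℝ) : AEStronglyMeasurable
    (fun u : ℝ => Real.exp (-u - x ^ 2 / (4 * u)) * u ^ (ν - 1)) (volume.restrict (Set.Ioi 0)) := by
  apply Measurable.aestronglyMeasurable
  fun_prop

lemma bk_gint (x : ℝ) {ν : ℝ} (hν : 0 < ν) : IntegrableOn
    (fun u : ℝ => Real.exp (-u - x ^ 2 / (4 * u)) * u ^ (ν - 1)) (Set.Ioi 0) := by
  refine Integrable.mono' (Real.GammaIntegral_convergent hν) (bk_meas x ν) ?_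
  filter_upwards [ae_restrict_mem measurableSet_Ioi] with u hu
  exact bk_bound x ν hu

lemma bk_deriv (c : ℝ) : ∀ t ∈ (Set.univ : Set ℝ),
    HasDerivWithinAt (fun t : ℝ => c * Real.exp t) (c * Real.exp t) Set.univ t := by
  intro t _
  exact ((Real.hasDerivAt_exp t).const_mul c).hasDerivWithinAt

lemma bk_inj {c : ℝ} (hc : 0 < c) : Set.InjOn (fun t : ℝ => c * Real.exp t) Set.univ := by
  intro a _ b _ h
  exact Real.exp_injective (mul_left_cancel₀ hc.ne' h)

lemma bk_int_exp {ν x : ℝ} (hν : 0 < ν) (hx : 0 < x) :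
    Integrable (fun t : ℝ => Real.exp (-x * Real.cosh t) * Real.exp (ν * t)) := by
  have h := bk_gint x hν
  have hc : 0 < x / 2 := by positivity
  rw [← bk_image hc, integrableOn_image_iff_integrableOn_abs_deriv_smul MeasurableSet.univ
    (bk_deriv _) (bk_inj hc), integrableOn_univ] at h
  simp only [bk_pt hx] at h
  have h3 := h.const_mul ((x / 2) ^ ν)⁻¹
  have h4 : (x / 2) ^ ν ≠ 0 := by positivity
  refine h3.congr (ae_of_all _ fun t => ?_)
  simp only
  rw [inv_mul_cancel_left₀ h4]

lemma bk_int_cosh {ν x : ℝ} (hx : 0 < x) :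
    Integrable (fun t : ℝ => Real.exp (-x * Real.cosh t) * Real.cosh (ν * t)) := by
  have h1 := bk_int_exp (ν := |ν| + 1) (by positivity) hx
  have h2 := h1.comp_neg
  refine Integrable.mono' (h1.add h2) (by apply Continuous.aestronglyMeasurable; fun_prop) ?_
  refine ae_of_all _ fun t => ?_
  have hp := Real.cosh_pos (ν * t)
  rw [Real.norm_of_nonneg (by positivity)]
  simp only [Pi.add_apply, Real.cosh_neg, ← mul_add]
  gcongr
  have : Real.cosh (ν * t) ≤ Real.cosh ((|ν| + 1) * t) := by
    rw [Real.cosh_le_cosh, abs_mul, abs_mul]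
    refine mul_le_mul_of_nonneg_right ?_ (abs_nonneg t)
    rw [abs_of_pos (show 0 < |ν| + 1 by positivity)]
    linarith
  refine this.trans ?_
  rw [Real.cosh_eq, mul_neg]
  have := Real.exp_pos ((|ν| + 1) * t)
  have := Real.exp_pos (-((|ν| + 1) * t))
  linarith

lemma bk_repr {ν x : ℝ} (hν : 0 < ν) (hx : 0 < x) :
    2 * (x / 2) ^ ν * besselK ν x
      = ∫ u in Set.Ioi (0 : ℝ), Real.exp (-u - x ^ 2 / (4 * u)) * u ^ (ν - 1) := by
  have hc : 0 < x / 2 := by positivity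
  have e1 := integral_image_eq_integral_abs_deriv_smul MeasurableSet.univ
    (bk_deriv (x / 2)) (bk_inj hc) (fun u : ℝ => Real.exp (-u - x ^ 2 / (4 * u)) * u ^ (ν - 1))
  rw [bk_image hc] at e1
  simp only [bk_pt hx] at e1
  rw [e1, setIntegral_univ, integral_const_mul]
  have e2 := integral_comp_abs (f := fun t : ℝ => Real.exp (-x * Real.cosh t) * Real.cosh (ν * t))
  have e3 : ∀ t : ℝ, Real.exp (-x * Real.cosh |t|) * Real.cosh (ν * |t|) =
      Real.exp (-x * Real.cosh t) * Real.cosh (ν * t) := by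
    intro t
    rcases abs_choice t with h | h <;> rw [h] <;> simp [Real.cosh_neg]
  simp only [e3] at e2
  have i1 := bk_int_exp hν hx
  have i2 := i1.comp_neg
  have e4 := integral_neg_eq_self
    (fun t : ℝ => Real.exp (-x * Real.cosh t) * Real.exp (ν * t)) volume
  have e5 : ∫ t : ℝ, Real.exp (-x * Real.cosh t) * Real.cosh (ν * t)
      = ∫ t : ℝ, Real.exp (-x * Real.cosh t) * Real.exp (ν * t) := by
    have e6 : ∀ t : ℝ, Real.exp (-x * Real.cosh t) * Real.cosh (ν * t) =
        (1 / 2) * (Real.exp (-x * Real.cosh t) * Real.exp (ν * t)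
          + Real.exp (-x * Real.cosh (-t)) * Real.exp (ν * (-t))) := by
      intro t
      rw [Real.cosh_eq (ν * t), Real.cosh_neg, mul_neg]
      ring
    simp only [e6]
    rw [integral_const_mul, integral_add i1 i2, e4]
    ring
  rw [← e5, e2, besselK]
  ring

lemma bk_lim0 {ν : ℝ} (hν : 0 < ν) :
    Tendsto (fun x : ℝ => 2 * (x / 2) ^ ν * besselK ν x) (𝓝[>] 0) (𝓝 (Real.Gamma ν)) := by
  have key : Tendsto (fun x : ℝ => ∫ u in Set.Ioi (0 : ℝ),
      Real.exp (-u - x ^ 2 / (4 * u)) * u ^ (ν - 1)) (𝓝[>] 0) (𝓝 (Real.Gamma ν)) := by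
    rw [Real.Gamma_eq_integral hν]
    refine tendsto_integral_filter_of_dominated_convergence
      (fun u => Real.exp (-u) * u ^ (ν - 1)) (Eventually.of_forall fun x => bk_meas x ν)
      (Eventually.of_forall fun x => ?_) (Real.GammaIntegral_convergent hν) (ae_of_all _ fun u => ?_)
    · filter_upwards [ae_restrict_mem measurableSet_Ioi] with u hu
      exact bk_bound x ν hu
    · have : Continuous (fun x : ℝ => Real.exp (-u - x ^ 2 / (4 * u)) * u ^ (ν - 1)) := by fun_prop
      have h := (this.tendsto 0).mono_left (nhdsWithin_le_nhds (s := Set.Ioi 0))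
      simpa using h
  refine key.congr' ?_
  filter_upwards [self_mem_nhdsWithin] with x hx
  exact (bk_repr hν hx).symm

lemma bk_int_sinh {ν x : ℝ} (hx : 0 < x) :
    Integrable (fun t : ℝ => Real.exp (-x * Real.cosh t) * Real.sinh (ν * t)) := by
  refine Integrable.mono' (bk_int_cosh (ν := ν) hx)
    (by apply Continuous.aestronglyMeasurable; fun_prop) (ae_of_all _ fun t => ?_)
  rw [norm_mul, Real.norm_of_nonneg (Real.exp_pos _).le]
  gcongr
  rw [Real.norm_eq_abs, abs_le]
  have h1 := Real.cosh_add_sinh (ν * t)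
  have h2 := Real.cosh_sub_sinh (ν * t)
  have := Real.exp_pos (ν * t)
  have := Real.exp_pos (-(ν * t))
  constructor <;> linarith

lemma bk_int_cc {ν x : ℝ} (hx : 0 < x) :
    Integrable (fun t : ℝ => Real.cosh t * Real.exp (-x * Real.cosh t) * Real.cosh (ν * t)) := by
  have h := ((bk_int_cosh (ν := ν + 1) hx).add (bk_int_cosh (ν := ν - 1) hx)).const_mul (1 / 2)
  refine h.congr (ae_of_all _ fun t => ?_)
  simp only [Pi.add_apply]
  rw [add_mul, sub_mul, one_mul, Real.cosh_add, Real.cosh_sub]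
  ring

lemma bk_int_ss {ν x : ℝ} (hx : 0 < x) :
    Integrable (fun t : ℝ => Real.sinh t * Real.exp (-x * Real.cosh t) * Real.sinh (ν * t)) := by
  have h := ((bk_int_cosh (ν := ν + 1) hx).sub (bk_int_cosh (ν := ν - 1) hx)).const_mul (1 / 2)
  refine h.congr (ae_of_all _ fun t => ?_)
  simp only [Pi.sub_apply]
  rw [add_mul, sub_mul, one_mul, Real.cosh_add, Real.cosh_sub]
  ring

lemma bk_hasDeriv (ν : ℝ) {x : ℝ} (hx : 0 < x) : HasDerivAt (besselK ν)
    (∫ t in Set.Ioi (0 : ℝ), -(Real.cosh t * Real.exp (-x * Real.cosh t) * Real.cosh (ν * t))) x := by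
  have hx2 : 0 < x / 2 := by positivity
  refine (hasDerivAt_integral_of_dominated_loc_of_deriv_le (μ := volume.restrict (Set.Ioi (0 : ℝ)))
    (F := fun x t => Real.exp (-x * Real.cosh t) * Real.cosh (ν * t))
    (F' := fun x t => -(Real.cosh t * Real.exp (-x * Real.cosh t) * Real.cosh (ν * t)))
    (bound := fun t => Real.cosh t * Real.exp (-(x / 2) * Real.cosh t) * Real.cosh (ν * t))
    (Ioi_mem_nhds (show x / 2 < x by linarith)) ?_ ?_ ?_ ?_ ?_ ?_).2
  · exact Eventually.of_forall fun y => by apply Continuous.aestronglyMeasurable; fun_prop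
  · exact (bk_int_cosh hx).integrableOn
  · apply Continuous.aestronglyMeasurable; fun_prop
  · refine ae_of_all _ fun t y hy => ?_
    have h1 := Real.cosh_pos t
    have h2 := Real.cosh_pos (ν * t)
    rw [norm_neg, Real.norm_of_nonneg (by positivity)]
    have : x / 2 ≤ y := le_of_lt hy
    gcongr
  · exact (bk_int_cc hx2).integrableOn
  · refine ae_of_all _ fun t y _ => ?_
    have h := (((hasDerivAt_id y).neg.mul_const (Real.cosh t)).exp).mul_const (Real.cosh (ν * t))
    refine h.congr_deriv ?_
    simp only [id, Pi.neg_apply]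
    ring

lemma bk_pos (ν : ℝ) {x : ℝ} (hx : 0 < x) : 0 < besselK ν x := by
  rw [besselK, setIntegral_pos_iff_support_of_nonneg_ae]
  · have : Function.support (fun t : ℝ => Real.exp (-x * Real.cosh t) * Real.cosh (ν * t))
        = Set.univ := by
      ext t
      have h1 := Real.cosh_pos (ν * t)
      simp only [Function.mem_support, Set.mem_univ, iff_true]
      positivity
    rw [this, Set.univ_inter, Real.volume_Ioi]
    exact ENNReal.zero_lt_top
  · refine ae_of_all _ fun t => ?_
    have h1 := Real.cosh_pos (ν * t)
    simp only [Pi.zero_apply]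
    positivity
  · exact (bk_int_cosh hx).integrableOn

lemma bk_parts (ν : ℝ) {x : ℝ} (hx : 0 < x) :
    ν * besselK ν x = x * ∫ t in Set.Ioi (0 : ℝ),
      Real.sinh t * Real.exp (-x * Real.cosh t) * Real.sinh (ν * t) := by
  have i1 := ((bk_int_cosh (ν := ν) hx).const_mul ν).integrableOn (s := Set.Ioi (0 : ℝ))
  have i2 := ((bk_int_ss (ν := ν) hx).const_mul x).integrableOn (s := Set.Ioi (0 : ℝ))
  have i3 := (bk_int_sinh (ν := ν) hx).integrableOn (s := Set.Ioi (0 : ℝ))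
  have i4 := i1.sub i2
  have hd : ∀ t ∈ Set.Ioi (0 : ℝ),
      HasDerivAt (fun t : ℝ => Real.exp (-x * Real.cosh t) * Real.sinh (ν * t))
      (ν * (Real.exp (-x * Real.cosh t) * Real.cosh (ν * t))
        - x * (Real.sinh t * Real.exp (-x * Real.cosh t) * Real.sinh (ν * t))) t := by
    intro t _
    have h1 := ((Real.hasDerivAt_cosh t).const_mul (-x)).exp
    have h2 := ((hasDerivAt_id t).const_mul ν).sinh
    refine (h1.mul h2).congr_deriv ?_
    simp only [id]
    ring
  have hl := tendsto_zero_of_hasDerivAt_of_integrableOn_Ioi hd i4 i3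
  have h := integral_Ioi_of_hasDerivAt_of_tendsto
    (by apply Continuous.continuousWithinAt; fun_prop) hd i4 hl
  rw [integral_sub i1 i2, integral_const_mul, integral_const_mul] at h
  simp only [mul_zero, Real.sinh_zero, sub_zero] at h
  rw [besselK]
  linarith

lemma bk_key {ν x : ℝ} (hν : 1 / 2 < ν) (hx : 0 < x) :
    0 < (1 + ν / x) * besselK ν x +
      ∫ t in Set.Ioi (0 : ℝ), -(Real.cosh t * Real.exp (-x * Real.cosh t) * Real.cosh (ν * t)) := by
  have hp := bk_parts ν hx
  have i1 := (bk_int_cosh (ν := ν) hx).integrableOn (s := Set.Ioi (0 : ℝ))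
  have i2 := (bk_int_ss (ν := ν) hx).integrableOn (s := Set.Ioi (0 : ℝ))
  have i3 := (bk_int_cc (ν := ν) hx).neg.integrableOn (s := Set.Ioi (0 : ℝ))
  have e1 : (1 + ν / x) * besselK ν x = besselK ν x + ∫ t in Set.Ioi (0 : ℝ),
      Real.sinh t * Real.exp (-x * Real.cosh t) * Real.sinh (ν * t) := by
    have : ν / x * besselK ν x = (ν * besselK ν x) / x := by ring
    rw [add_mul, one_mul, this, hp, mul_div_cancel_left₀ _ hx.ne']
  have e2 : (besselK ν x + ∫ t in Set.Ioi (0 : ℝ),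
      Real.sinh t * Real.exp (-x * Real.cosh t) * Real.sinh (ν * t)) +
      (∫ t in Set.Ioi (0 : ℝ), -(Real.cosh t * Real.exp (-x * Real.cosh t) * Real.cosh (ν * t)))
      = ∫ t in Set.Ioi (0 : ℝ), ((Real.exp (-x * Real.cosh t) * Real.cosh (ν * t)
        + Real.sinh t * Real.exp (-x * Real.cosh t) * Real.sinh (ν * t))
        + -(Real.cosh t * Real.exp (-x * Real.cosh t) * Real.cosh (ν * t))) := by
    have q1 := integral_add (i1.add i2) i3
    have q2 := integral_add i1 i2
    simp only [Pi.add_apply, Pi.neg_apply] at q1 q2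
    rw [q1, q2, besselK]
  have e3 : ∀ t : ℝ, ((Real.exp (-x * Real.cosh t) * Real.cosh (ν * t)
        + Real.sinh t * Real.exp (-x * Real.cosh t) * Real.sinh (ν * t))
        + -(Real.cosh t * Real.exp (-x * Real.cosh t) * Real.cosh (ν * t)))
      = Real.exp (-x * Real.cosh t) * (Real.cosh (ν * t) - Real.cosh ((ν - 1) * t)) := by
    intro t
    rw [sub_mul, one_mul, Real.cosh_sub]
    ring
  have i5 : IntegrableOn (fun t : ℝ => Real.exp (-x * Real.cosh t) *
      (Real.cosh (ν * t) - Real.cosh ((ν - 1) * t))) (Set.Ioi 0) := by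
    refine ((i1.add i2).add i3).congr (ae_of_all _ fun t => ?_)
    exact e3 t
  rw [e1, e2]
  simp only [e3]
  have hpos : ∀ t ∈ Set.Ioi (0 : ℝ), 0 < Real.exp (-x * Real.cosh t) *
      (Real.cosh (ν * t) - Real.cosh ((ν - 1) * t)) := by
    intro t ht
    have ht' : 0 < t := ht
    refine mul_pos (Real.exp_pos _) (sub_pos.2 ?_)
    rw [Real.cosh_lt_cosh, abs_mul, abs_mul]
    refine mul_lt_mul_of_pos_right ?_ (abs_pos.2 ht'.ne')
    rw [abs_of_pos (show 0 < ν by linarith), abs_lt]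
    constructor <;> linarith
  rw [setIntegral_pos_iff_support_of_nonneg_ae _ i5]
  · have : Function.support (fun t : ℝ => Real.exp (-x * Real.cosh t) *
        (Real.cosh (ν * t) - Real.cosh ((ν - 1) * t))) ∩ Set.Ioi 0 = Set.Ioi 0 :=
      Set.inter_eq_right.2 fun t ht => (hpos t ht).ne'
    rw [this, Real.volume_Ioi]
    exact ENNReal.zero_lt_top
  · filter_upwards [ae_restrict_mem measurableSet_Ioi] with t ht
    exact (hpos t ht).le

lemma bk_arg_pos {ν x : ℝ} (hν : 0 < ν) (hx : 0 < x) :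
    0 < 2 * (x / 2) ^ ν * besselK ν x / Real.Gamma ν := by
  have h1 := bk_pos ν hx
  have h2 := Real.Gamma_pos_of_pos hν
  positivity

lemma psiK_hasDeriv {ν x : ℝ} (hν : 1 / 2 < ν) (hx : 0 < x) :
    ∃ d, 0 < d ∧ HasDerivAt (psiK ν) d x := by
  have hK := bk_pos ν hx
  have hν0 : 0 < ν := by linarith
  have hG := Real.Gamma_pos_of_pos hν0
  have hd := bk_hasDeriv ν hx
  have hkey := bk_key hν hx
  set K' := ∫ t in Set.Ioi (0 : ℝ),
    -(Real.cosh t * Real.exp (-x * Real.cosh t) * Real.cosh (ν * t)) with hK'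
  refine ⟨1 + (ν / x + K' / besselK ν x), ?_, ?_⟩
  · have : 1 + (ν / x + K' / besselK ν x) = ((1 + ν / x) * besselK ν x + K') / besselK ν x := by
      field_simp
      ring
    rw [this]
    exact div_pos hkey hK
  · have h1 : HasDerivAt (fun y => y + (Real.log 2 + ν * (Real.log y - Real.log 2)
        + Real.log (besselK ν y) - Real.log (Real.Gamma ν))) (1 + (ν / x + K' / besselK ν x)) x := by
      have a1 := (((Real.hasDerivAt_log hx.ne').sub_const (Real.log 2)).const_mul ν).const_add
        (Real.log 2)
      have a2 := hd.log hK.ne'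
      refine ((hasDerivAt_id x).add ((a1.add a2).sub_const (Real.log (Real.Gamma ν)))).congr_deriv ?_
      ring
    refine h1.congr_of_eventuallyEq ?_
    filter_upwards [Ioi_mem_nhds hx] with y hy
    have hy' : 0 < y := hy
    have hKy := bk_pos ν hy'
    have hpow : 0 < (y / 2) ^ ν := by positivity
    rw [psiK, if_neg hy'.ne', Real.log_div (by positivity) hG.ne',
      Real.log_mul (by positivity) hKy.ne', Real.log_mul (by norm_num) hpow.ne',
      Real.log_rpow (by positivity), Real.log_div hy'.ne' (by norm_num)]

lemma psiK_cont {ν : ℝ} (hν : 1 / 2 < ν) : ContinuousOn (psiK ν) (Set.Ici 0) := by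
  have hν0 : 0 < ν := by linarith
  have hG := Real.Gamma_pos_of_pos hν0
  intro x hx
  rcases (show (0 : ℝ) ≤ x from hx).eq_or_lt with rfl | hx'
  · rw [← continuousWithinAt_Ioi_iff_Ici, ContinuousWithinAt]
    have h1 := ((bk_lim0 hν0).div_const (Real.Gamma ν)).log (by rw [div_self hG.ne']; norm_num)
    rw [div_self hG.ne', Real.log_one] at h1
    have h2 : Tendsto (fun x : ℝ => x) (𝓝[>] 0) (𝓝 0) :=
      tendsto_id.mono_left nhdsWithin_le_nhds
    have h3 := h2.add h1
    have h0 : psiK ν 0 = 0 + 0 := by simp [psiK]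
    rw [h0]
    refine h3.congr' ?_
    filter_upwards [self_mem_nhdsWithin] with y hy
    rw [psiK, if_neg (ne_of_gt hy)]
  · obtain ⟨d, _, h⟩ := psiK_hasDeriv hν hx'
    exact h.continuousAt.continuousWithinAt

lemma bk_lower {ν x : ℝ} (hx : 1 ≤ x) :
    Real.exp (-x) * Real.exp (-1) * x ^ (-(1 / 2) : ℝ) ≤ besselK ν x := by
  have hx0 : 0 < x := by linarith
  set δ : ℝ := x ^ (-(1 / 2) : ℝ) with hδ
  have hδ0 : 0 < δ := by positivity
  have hδ1 : δ ≤ 1 := Real.rpow_le_one_of_one_le_of_nonpos hx (by norm_num)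
  have hδ2 : x * δ ^ 2 = 1 := by
    rw [hδ, ← Real.rpow_natCast, ← Real.rpow_mul hx0.le]
    norm_num
    rw [Real.rpow_neg_one, mul_inv_cancel₀ hx0.ne']
  have i1 := (bk_int_cosh (ν := ν) hx0).integrableOn (s := Set.Ioi (0 : ℝ))
  have s1 : ∫ t in Set.Ioc (0 : ℝ) δ, Real.exp (-x * Real.cosh t) * Real.cosh (ν * t)
      ≤ besselK ν x := by
    refine setIntegral_mono_set i1 (ae_of_all _ fun t => ?_)
      (LE.le.eventuallyLE Set.Ioc_subset_Ioi_self)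
    have h1 := Real.cosh_pos (ν * t)
    simp only [Pi.zero_apply]
    positivity
  refine le_trans ?_ s1
  have s2 : ∫ t in Set.Ioc (0 : ℝ) δ, Real.exp (-x) * Real.exp (-1)
      ≤ ∫ t in Set.Ioc (0 : ℝ) δ, Real.exp (-x * Real.cosh t) * Real.cosh (ν * t) := by
    refine setIntegral_mono_on
      (integrableOn_const (by simp)) (i1.mono_set Set.Ioc_subset_Ioi_self)
      measurableSet_Ioc fun t ht => ?_
    have ht2 : t ^ 2 ≤ δ ^ 2 := by
      have := ht.1
      have := ht.2
      gcongr
    have ht3 : δ ^ 2 ≤ 1 := by nlinarith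
    have c1 : Real.cosh t ≤ 1 + t ^ 2 := by
      have a := Real.cosh_le_exp_half_sq t
      have b := Real.abs_exp_sub_one_le (x := t ^ 2 / 2) (by
        rw [abs_of_nonneg (by positivity)]
        linarith)
      rw [abs_of_nonneg (show 0 ≤ t ^ 2 / 2 by positivity)] at b
      have := (abs_le.1 b).2
      linarith
    have c2 : x * Real.cosh t ≤ x + 1 := by nlinarith
    have c3 := Real.one_le_cosh (ν * t)
    rw [← Real.exp_add]
    have c4 : Real.exp (-x + -1) ≤ Real.exp (-x * Real.cosh t) := by
      apply Real.exp_le_exp.2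
      linarith
    nlinarith [Real.exp_pos (-x * Real.cosh t)]
  refine le_trans (le_of_eq ?_) s2
  rw [setIntegral_const]
  simp [hδ0.le, mul_comm]

lemma psiK_top {ν : ℝ} (hν : 1 / 2 < ν) : Tendsto (psiK ν) atTop atTop := by
  have hν0 : 0 < ν := by linarith
  have hG := Real.Gamma_pos_of_pos hν0
  have h1 : Tendsto (fun x : ℝ => (ν - 1 / 2) * Real.log x +
      (Real.log 2 - ν * Real.log 2 - 1 - Real.log (Real.Gamma ν))) atTop atTop :=
    tendsto_atTop_add_const_right _ _
      (Real.tendsto_log_atTop.const_mul_atTop (by linarith))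
  refine tendsto_atTop_mono' _ ?_ h1
  filter_upwards [eventually_ge_atTop 1] with y hy
  have hy' : 0 < y := by linarith
  have hKy := bk_pos ν hy'
  have hpow : 0 < (y / 2) ^ ν := by positivity
  have hl := Real.log_le_log (by positivity) (bk_lower (ν := ν) hy)
  rw [Real.log_mul (by positivity) (by positivity), Real.log_mul (by positivity) (by positivity),
    Real.log_exp, Real.log_exp, Real.log_rpow hy'] at hl
  rw [psiK, if_neg hy'.ne', Real.log_div (by positivity) hG.ne',
    Real.log_mul (by positivity) hKy.ne', Real.log_mul (by norm_num) hpow.ne',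
    Real.log_rpow (by positivity), Real.log_div hy'.ne' (by norm_num)]
  linarith

theorem psiK_strictMono_bijOn {ν : ℝ} (hν : 1/2 < ν) :
    StrictMonoOn (psiK ν) (Set.Ici (0 : ℝ)) ∧
      Set.BijOn (psiK ν) (Set.Ici (0 : ℝ)) (Set.Ici (0 : ℝ)) := by
  have hmono : StrictMonoOn (psiK ν) (Set.Ici (0 : ℝ)) := by
    refine strictMonoOn_of_deriv_pos (convex_Ici 0) (psiK_cont hν) fun x hx => ?_
    rw [interior_Ici] at hx
    obtain ⟨d, hd, h⟩ := psiK_hasDeriv hν hx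
    rw [h.deriv]
    exact hd
  have h0 : psiK ν 0 = 0 := by simp [psiK]
  refine ⟨hmono, ?_, hmono.injOn, ?_⟩
  · intro x hx
    have := hmono.monotoneOn (Set.self_mem_Ici) hx hx
    rw [h0] at this
    exact this
  · intro y hy
    obtain ⟨b, hb, hb0⟩ := (((psiK_top hν).eventually_ge_atTop y).and
      (eventually_ge_atTop 0)).exists
    have hsub := intermediate_value_Icc hb0 ((psiK_cont hν).mono Set.Icc_subset_Ici_self)
    obtain ⟨z, hz, rfl⟩ := hsub ⟨by rw [h0]; exact hy, hb⟩
    exact ⟨z, hz.1, rfl⟩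
end

section
/- For ν > 1/2, as n → ∞, K_n = ∫_0^∞ (2e^x (x/2)^ν K_ν(x)/Γ(ν))^{-n} dx satisfies K_n = 1/n + o(1/n). -/
open Real Filter Asymptotics

section BesselAux

open MeasureTheory Set Topology

lemma gam_int {ν : ℝ} (hν : 0 < ν) (x : ℝ) :
    IntegrableOn (fun s : ℝ => Real.exp (-s - x^2/(4*s)) * s^(ν-1)) (Ioi 0) := by
  refine (Real.GammaIntegral_convergent hν).mono' ?_ ?_
  · refine ContinuousOn.aestronglyMeasurable ?_ measurableSet_Ioi
    intro s hs
    have hs : (0:ℝ) < s := hs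
    refine ContinuousAt.continuousWithinAt ?_
    refine ContinuousAt.mul ?_ (Real.continuousAt_rpow_const _ _ (Or.inl hs.ne'))
    refine ContinuousAt.rexp (ContinuousAt.sub (by fun_prop) ?_)
    exact ContinuousAt.div (by fun_prop) (by fun_prop) (by positivity)
  · refine (ae_restrict_iff' measurableSet_Ioi).2 (ae_of_all _ fun s hs => ?_)
    have hs : (0:ℝ) < s := hs
    rw [Real.norm_of_nonneg (by positivity)]
    gcongr
    have : 0 ≤ x^2/(4*s) := by positivity
    linarith

/-- pull back to exponential coordinates -/
lemma img_exp {x : ℝ} (hx : 0 < x) : (fun t : ℝ => x/2 * Real.exp t) '' univ = Ioi 0 := by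
  ext s
  simp only [image_univ, mem_range, mem_Ioi]
  constructor
  · rintro ⟨t, rfl⟩; positivity
  · intro hs
    refine ⟨Real.log (s/(x/2)), ?_⟩
    rw [Real.exp_log (by positivity)]
    field_simp

lemma inj_exp {x : ℝ} (hx : 0 < x) : InjOn (fun t : ℝ => x/2 * Real.exp t) univ := by
  intro a _ b _ h
  have h : x/2 * Real.exp a = x/2 * Real.exp b := h
  exact Real.exp_injective (mul_left_cancel₀ (by positivity) h)

lemma der_exp (x : ℝ) : ∀ t ∈ (univ : Set ℝ),
    HasDerivWithinAt (fun t : ℝ => x/2 * Real.exp t) (x/2 * Real.exp t) univ t :=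
  fun t _ => ((Real.hasDerivAt_exp t).const_mul (x/2)).hasDerivWithinAt

lemma integrand_exp {x : ℝ} (hx : 0 < x) (ν t : ℝ) :
    |x/2 * Real.exp t| • (Real.exp (-(x/2 * Real.exp t) - x^2/(4*(x/2 * Real.exp t))) *
      (x/2 * Real.exp t)^(ν-1)) = (x/2)^ν * (Real.exp (-x * Real.cosh t) * Real.exp (ν * t)) := by
  have h1 : 0 < x/2 * Real.exp t := by positivity
  have h2 : -(x/2 * Real.exp t) - x^2/(4*(x/2 * Real.exp t)) = -x * Real.cosh t := by
    rw [Real.cosh_eq, Real.exp_neg]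
    field_simp
    ring
  rw [h2, abs_of_pos h1, smul_eq_mul, Real.rpow_sub_one h1.ne', Real.mul_rpow (by positivity)
    (by positivity), ← Real.exp_mul, mul_comm t ν]
  field_simp

lemma exp_int {ν : ℝ} (hν : 0 < ν) {x : ℝ} (hx : 0 < x) :
    Integrable (fun t : ℝ => Real.exp (-x * Real.cosh t) * Real.exp (ν * t)) := by
  have h := gam_int hν x
  rw [← img_exp hx, integrableOn_image_iff_integrableOn_abs_deriv_smul MeasurableSet.univ
    (der_exp x) (inj_exp hx)] at h
  simp only [integrand_exp hx, integrableOn_univ] at h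
  have hp : (x/2)^ν ≠ 0 := by positivity
  exact (integrable_const_mul_iff (IsUnit.mk0 _ hp) _).1 h

lemma bess_eq {ν : ℝ} (hν : 0 < ν) {x : ℝ} (hx : 0 < x) :
    2 * (x/2)^ν * besselK ν x = ∫ s in Ioi (0:ℝ), Real.exp (-s - x^2/(4*s)) * s^(ν-1) := by
  rw [← img_exp hx, integral_image_eq_integral_abs_deriv_smul MeasurableSet.univ
    (der_exp x) (inj_exp hx)]
  simp only [integrand_exp hx]
  have hi := exp_int hν hx
  rw [setIntegral_univ, integral_const_mul, ← intervalIntegral.integral_Iic_add_Ioi (b := 0)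
    hi.integrableOn hi.integrableOn]
  have hn := integral_comp_neg_Ioi 0 (fun t : ℝ => Real.exp (-x * Real.cosh t) * Real.exp (ν * t))
  rw [neg_zero] at hn
  rw [← hn, ← integral_add]
  · unfold besselK
    rw [mul_comm 2, mul_assoc, ← integral_const_mul]
    congr 2
    ext t
    rw [Real.cosh_neg, Real.cosh_eq (ν * t), mul_neg]
    ring
  · exact hi.comp_neg.integrableOn
  · exact hi.integrableOn

lemma bess_int {ν : ℝ} (hν : 0 < ν) {x : ℝ} (hx : 0 < x) :
    IntegrableOn (fun t : ℝ => Real.exp (-x * Real.cosh t) * Real.cosh (ν * t)) (Ioi 0) := by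
  have hi := exp_int hν hx
  have := ((hi.add hi.comp_neg).const_mul (1/2)).integrableOn (s := Ioi 0)
  refine this.congr_fun (fun t _ => ?_) measurableSet_Ioi
  simp only [Pi.add_apply, Real.cosh_neg, mul_neg]
  rw [Real.cosh_eq (ν * t)]
  ring

lemma bess_half {x : ℝ} (hx : 0 < x) : besselK (1/2) x = Real.exp (-x) * √(π/(2*x)) := by
  have himg : (fun t : ℝ => Real.sinh (t/2)) '' (Ioi 0) = Ioi 0 := by
    ext s
    simp only [mem_image, mem_Ioi]
    constructor
    · rintro ⟨t, ht, rfl⟩; exact Real.sinh_pos_iff.2 (by positivity)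
    · intro hs
      refine ⟨2 * Real.arsinh s, by have := Real.arsinh_pos_iff.2 hs; positivity, ?_⟩
      rw [mul_div_cancel_left₀ _ (by norm_num), Real.sinh_arsinh]
  have hinj : InjOn (fun t : ℝ => Real.sinh (t/2)) (Ioi 0) := by
    intro a _ b _ h
    have := Real.sinh_injective h
    linarith
  have hder : ∀ t ∈ Ioi (0:ℝ), HasDerivWithinAt (fun t : ℝ => Real.sinh (t/2))
      (Real.cosh (t/2) * (1/2)) (Ioi 0) t := fun t _ =>
    (((hasDerivAt_id' t).div_const 2).sinh).hasDerivWithinAt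
  have hg := integral_gaussian_Ioi (2*x)
  rw [← himg, integral_image_eq_integral_abs_deriv_smul measurableSet_Ioi hder hinj] at hg
  unfold besselK
  have : ∀ t : ℝ, Real.exp (-x * Real.cosh t) * Real.cosh (1/2 * t) =
    (2 * Real.exp (-x)) * (|Real.cosh (t/2) * (1/2)| • Real.exp (-(2*x) * (Real.sinh (t/2))^2)) := by
    intro t
    have h1 : Real.cosh t = 1 + 2 * Real.sinh (t/2)^2 := by
      have := Real.cosh_two_mul (t/2)
      rw [Real.cosh_sq, mul_div_cancel₀ _ (by norm_num)] at this
      linarith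
    have h2 := Real.cosh_pos (t/2)
    rw [abs_of_pos (by positivity), h1, smul_eq_mul, mul_add, Real.exp_add, mul_one,
      show (1/2 * t) = t/2 by ring, show -x * (2 * Real.sinh (t/2)^2) = -(2*x) * Real.sinh (t/2)^2 by ring]
    ring
  simp only [this]
  rw [integral_const_mul, hg]
  ring

lemma bess_lower {ν : ℝ} (hν : 1/2 < ν) {x : ℝ} (hx : 0 < x) :
    Real.exp (-x) * √(π/(2*x)) ≤ besselK ν x := by
  rw [← bess_half hx]
  unfold besselK
  refine setIntegral_mono_on (bess_int (by norm_num) hx) (bess_int (by linarith) hx)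
    measurableSet_Ioi fun t ht => ?_
  have ht : (0:ℝ) < t := ht
  gcongr
  rw [Real.cosh_le_cosh, abs_of_pos (by positivity), abs_of_pos (by nlinarith)]
  gcongr

/-- the normalised integral -/
noncomputable def GG (ν x : ℝ) : ℝ :=
  (∫ s in Ioi (0:ℝ), Real.exp (-s - x^2/(4*s)) * s^(ν-1)) / Real.Gamma ν

lemma GG_half {x : ℝ} (hx : 0 < x) : GG (1/2) x = Real.exp (-x) := by
  unfold GG
  rw [← bess_eq (by norm_num) hx, bess_half hx, Real.Gamma_one_half_eq, ← Real.sqrt_eq_rpow]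
  have h : √(x/2) * √(π/(2*x)) = √π / 2 := by
    rw [← Real.sqrt_mul (by positivity), show x/2 * (π/(2*x)) = π / 2^2 by field_simp; try norm_num,
      Real.sqrt_div (by positivity), Real.sqrt_sq (by norm_num)]
  have hp : 0 < √π := by positivity
  rw [div_eq_iff hp.ne']
  linear_combination (2 * Real.exp (-x)) * h

lemma GG_gt {ν : ℝ} (hν : 1/2 < ν) {x : ℝ} (hx : 0 < x) : Real.exp (-x) < GG ν x := by
  rw [← GG_half hx]
  have hG : 0 < Real.Gamma ν := Real.Gamma_pos_of_pos (by linarith)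
  have hG' : 0 < Real.Gamma (1/2) := Real.Gamma_pos_of_pos (by norm_num)
  set b := ν - 1/2 with hb
  have hb0 : 0 < b := by linarith
  set m := Real.Gamma ν / Real.Gamma (1/2) with hm
  have hm0 : 0 < m := by positivity
  set s0 := m ^ (1/b) with hs0
  have hs0p : 0 < s0 := by positivity
  have hs0b : s0 ^ b = m := by
    rw [hs0, ← Real.rpow_mul hm0.le, one_div_mul_cancel hb0.ne', Real.rpow_one]
  set c := Real.exp (-(x^2/(4*s0))) with hc
  have i1 := gam_int (ν := ν) (by linarith) x
  have i2 := gam_int (ν := 1/2) (by linarith) x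
  have i3 := Real.GammaIntegral_convergent (s := ν) (by linarith)
  have i4 := Real.GammaIntegral_convergent (s := 1/2) (by linarith)
  have key : 0 < ∫ s in Ioi (0:ℝ), ((Real.exp (-s - x^2/(4*s)) * s^(ν-1)
      - m * (Real.exp (-s - x^2/(4*s)) * s^((1/2:ℝ)-1))) - (c * (Real.exp (-s) * s^(ν-1))
      - c * m * (Real.exp (-s) * s^((1/2:ℝ)-1)))) := by
    have hform : ∀ s ∈ Ioi (0:ℝ), ((Real.exp (-s - x^2/(4*s)) * s^(ν-1)
      - m * (Real.exp (-s - x^2/(4*s)) * s^((1/2:ℝ)-1))) - (c * (Real.exp (-s) * s^(ν-1))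
      - c * m * (Real.exp (-s) * s^((1/2:ℝ)-1)))) = Real.exp (-s) * s^((1/2:ℝ)-1) *
        ((s^b - s0^b) * (Real.exp (-(x^2/(4*s))) - c)) := by
      intro s hs
      have hs : 0 < s := hs
      rw [show ν - 1 = b + ((1/2:ℝ)-1) by rw [hb]; ring, Real.rpow_add hs, hs0b,
        sub_eq_add_neg (-s), Real.exp_add]
      ring
    have hpos : ∀ s ∈ Ioi (0:ℝ), s ≠ s0 → 0 < (s^b - s0^b) * (Real.exp (-(x^2/(4*s))) - c) := by
      intro s hs hne
      have hs : 0 < s := hs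
      rcases lt_or_gt_of_ne hne with h | h
      · have h1 : s^b < s0^b := Real.rpow_lt_rpow hs.le h hb0
        have h2 : Real.exp (-(x^2/(4*s))) < c := by
          rw [hc]; apply Real.exp_lt_exp.2; apply neg_lt_neg; gcongr
        exact mul_pos_of_neg_of_neg (by linarith) (by linarith)
      · have h1 : s0^b < s^b := Real.rpow_lt_rpow hs0p.le h hb0
        have h2 : c < Real.exp (-(x^2/(4*s))) := by
          rw [hc]; apply Real.exp_lt_exp.2; apply neg_lt_neg; gcongr
        exact mul_pos (by linarith) (by linarith)
    rw [setIntegral_pos_iff_support_of_nonneg_ae]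
    · refine lt_of_lt_of_le (b := volume (Ioi s0)) (by simp) (measure_mono fun s hs => ?_)
      have hs : s0 < s := hs
      have hs' : s ∈ Ioi (0:ℝ) := hs0p.trans hs
      refine ⟨?_, hs'⟩
      rw [Function.mem_support, hform s hs']
      have := hpos s hs' hs.ne'
      have h0 : 0 < s := hs'
      positivity
    · refine (ae_restrict_iff' measurableSet_Ioi).2 (ae_of_all _ fun s hs => ?_)
      refine le_of_le_of_eq ?_ (hform s hs).symm
      have h0 : 0 < s := hs
      have : 0 ≤ (s^b - s0^b) * (Real.exp (-(x^2/(4*s))) - c) := by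
        by_cases h : s = s0
        · simp [h]
        · exact (hpos s hs h).le
      simp only [Pi.zero_apply]
      positivity
    · exact (i1.sub (i2.const_mul m)).sub ((i3.const_mul c).sub (i4.const_mul (c*m)))
  have j1 : IntegrableOn (fun s : ℝ => Real.exp (-s - x^2/(4*s)) * s^(ν-1)
      - m * (Real.exp (-s - x^2/(4*s)) * s^((1/2:ℝ)-1))) (Ioi 0) := i1.sub (i2.const_mul m)
  have j2 : IntegrableOn (fun s : ℝ => c * (Real.exp (-s) * s^(ν-1))
      - c * m * (Real.exp (-s) * s^((1/2:ℝ)-1))) (Ioi 0) :=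
    (i3.const_mul c).sub (i4.const_mul (c*m))
  rw [integral_sub j1 j2,
    integral_sub i1 (i2.const_mul m), integral_sub (i3.const_mul c) (i4.const_mul (c*m)),
    integral_const_mul, integral_const_mul, integral_const_mul, ← Real.Gamma_eq_integral (by linarith),
    ← Real.Gamma_eq_integral (by norm_num)] at key
  have hmm : m * Real.Gamma (1/2) = Real.Gamma ν := by rw [hm]; field_simp
  have hz : c * Real.Gamma ν - c * m * Real.Gamma (1/2) = 0 := by rw [mul_assoc, hmm]; ring
  rw [hz] at key
  unfold GG
  rw [div_lt_div_iff₀ hG' hG, ← hmm]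
  nlinarith

lemma GG_le {ν : ℝ} (hν : 0 < ν) (x : ℝ) : GG ν x ≤ 1 := by
  unfold GG
  rw [div_le_one (Real.Gamma_pos_of_pos hν), Real.Gamma_eq_integral hν]
  refine setIntegral_mono_on (gam_int hν x) (Real.GammaIntegral_convergent hν)
    measurableSet_Ioi fun s hs => ?_
  have hs : (0:ℝ) < s := hs
  gcongr
  have : 0 ≤ x^2/(4*s) := by positivity
  linarith

lemma one_sub_exp_le {y p : ℝ} (hy : 0 < y) (hp0 : 0 < p) (hp : p ≤ 1) : 1 - Real.exp (-y) ≤ y^p := by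
  rcases le_total y 1 with h | h
  · have h1 := Real.add_one_le_exp (-y)
    have h2 : y^(1:ℝ) ≤ y^p := Real.rpow_le_rpow_of_exponent_ge hy h hp
    rw [Real.rpow_one] at h2
    linarith
  · have := Real.one_le_rpow h hp0.le
    have := Real.exp_pos (-y)
    linarith

lemma GG_lower {ν p : ℝ} (hν : p < ν) (hp0 : 0 < p) (hp : p ≤ 1) {x : ℝ} (hx : 0 < x) :
    1 - GG ν x ≤ (x^2/4)^p * (Real.Gamma (ν-p) / Real.Gamma ν) := by
  have hν0 : 0 < ν := by linarith
  have hG := Real.Gamma_pos_of_pos hν0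
  unfold GG
  rw [← mul_div_assoc, one_sub_div hG.ne']
  gcongr
  rw [Real.Gamma_eq_integral (show 0 < ν - p by linarith), Real.Gamma_eq_integral hν0,
    ← integral_const_mul, ← integral_sub (Real.GammaIntegral_convergent hν0) (gam_int hν0 x)]
  refine setIntegral_mono_on ((Real.GammaIntegral_convergent hν0).sub (gam_int hν0 x))
    ((Real.GammaIntegral_convergent (by linarith)).const_mul _) measurableSet_Ioi fun s hs => ?_
  have hs : (0:ℝ) < s := hs
  have h := one_sub_exp_le (y := (x^2/4)/s) (by positivity) hp0 hp
  rw [Real.div_rpow (by positivity) hs.le] at h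
  rw [show ν - p - 1 = (ν - 1) - p by ring, Real.rpow_sub hs (ν-1) p, sub_eq_add_neg (-s),
    Real.exp_add, show x^2/(4*s) = (x^2/4)/s by field_simp]
  have h3 : 0 ≤ Real.exp (-s) * s^(ν-1) := by positivity
  have := mul_le_mul_of_nonneg_left h h3
  calc _ = Real.exp (-s) * s^(ν-1) * (1 - Real.exp (-(x^2/4/s))) := by ring
    _ ≤ _ := this
    _ = _ := by ring

lemma GG_cont {ν : ℝ} (hν : 0 < ν) : Continuous (GG ν) := by
  unfold GG
  refine Continuous.div_const ?_ _
  refine continuous_of_dominated (bound := fun s : ℝ => Real.exp (-s) * s^(ν-1))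
    (fun x => (gam_int hν x).aestronglyMeasurable) (fun x => ?_)
    (Real.GammaIntegral_convergent hν) (ae_of_all _ fun s => by fun_prop)
  refine (ae_restrict_iff' measurableSet_Ioi).2 (ae_of_all _ fun s hs => ?_)
  have hs : (0:ℝ) < s := hs
  rw [Real.norm_of_nonneg (by positivity)]
  gcongr
  have : 0 ≤ x^2/(4*s) := by positivity
  linarith

lemma GG_tendsto {ν : ℝ} (hν : 1/2 < ν) : Tendsto (fun x => (GG ν x - 1)/x) (𝓝[>] 0) (𝓝 0) := by
  obtain ⟨p, hp1, hp2⟩ := exists_between (lt_min hν (by norm_num : (1/2:ℝ) < 1))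
  have hpν := hp2.trans_le (min_le_left _ _)
  have hp := hp2.trans_le (min_le_right _ _)
  set C := (1/4:ℝ)^p * (Real.Gamma (ν-p) / Real.Gamma ν) with hC
  have hl : Tendsto (fun x : ℝ => -(C * x^(2*p-1))) (𝓝[>] 0) (𝓝 0) := by
    have h1 : Tendsto (fun x : ℝ => x^(2*p-1)) (𝓝 0) (𝓝 (0^(2*p-1))) :=
      (Real.continuousAt_rpow_const 0 _ (Or.inr (by linarith)))
    rw [Real.zero_rpow (by linarith)] at h1
    simpa using ((h1.mono_left nhdsWithin_le_nhds).const_mul C).neg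
  refine tendsto_of_tendsto_of_tendsto_of_le_of_le' hl tendsto_const_nhds ?_ ?_
  · filter_upwards [self_mem_nhdsWithin] with x hx
    have hx : 0 < x := hx
    have h := GG_lower hpν (by linarith) hp.le hx
    rw [le_div_iff₀ hx, Real.rpow_sub_one hx.ne', Real.rpow_mul hx.le]
    rw [show x^2/4 = x^2 * (1/4) by ring, Real.mul_rpow (by positivity) (by positivity)] at h
    have e : -(C * ((x^(2:ℝ))^p / x)) * x = -(C * (x^(2:ℝ))^p) := by field_simp
    rw [e, hC, Real.rpow_two]
    linarith
  · filter_upwards [self_mem_nhdsWithin] with x hx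
    have hx : 0 < x := hx
    have := GG_le (ν := ν) (by linarith) x
    exact div_nonpos_of_nonpos_of_nonneg (by linarith) hx.le

lemma exists_lower {F : ℝ → ℝ} {b c : ℝ} (hb : 0 < b) (hc : 0 < c) (hF : ContinuousOn F (Ioi 0))
    (h1 : ∀ x, 0 < x → 1 < F x) (h0 : ∀ᶠ x in 𝓝[>] (0:ℝ), 1 + x/2 ≤ F x)
    (hi : ∀ x, 0 < x → c * x^b ≤ F x) : ∃ a : ℝ, 0 < a ∧ ∀ x, 0 < x → (1 + x/2)^a ≤ F x := by
  obtain ⟨δ, hδ, hδF⟩ := mem_nhdsGT_iff_exists_Ioo_subset.1 h0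
  have hδ : 0 < δ := hδ
  have ht : ∀ᶠ x in atTop, 1 ≤ c * x^(b/2) :=
    ((tendsto_rpow_atTop (by positivity : 0 < b/2)).const_mul_atTop hc).eventually_ge_atTop 1
  obtain ⟨M, hM⟩ := eventually_atTop.1 (ht.and ((eventually_ge_atTop 2).and (eventually_ge_atTop δ)))
  have hMδ := (hM M le_rfl).2.2
  have hM2 := (hM M le_rfl).2.1
  have hne : (Icc δ M).Nonempty := ⟨δ, le_rfl, hMδ⟩
  obtain ⟨z, hz, hzm⟩ := isCompact_Icc.exists_isMinOn hne
    (hF.mono fun x (hx : x ∈ Icc δ M) => (lt_of_lt_of_le hδ hx.1 : (0:ℝ) < x))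
  have hz1 := h1 z (hδ.trans_le hz.1)
  have hlM : 0 < Real.log (1 + M/2) := Real.log_pos (by linarith)
  have hlz : 0 < Real.log (F z) := Real.log_pos hz1
  refine ⟨min 1 (min (b/2) (Real.log (F z) / Real.log (1+M/2))), by positivity, fun x hx => ?_⟩
  set a := min 1 (min (b/2) (Real.log (F z) / Real.log (1+M/2))) with ha
  have ha0 : 0 < a := by positivity
  have ha1 : a ≤ 1 := min_le_left _ _
  have ha2 : a ≤ b/2 := (min_le_right _ _).trans (min_le_left _ _)
  have ha3 : a ≤ Real.log (F z) / Real.log (1+M/2) := (min_le_right _ _).trans (min_le_right _ _)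
  have hx1 : 1 ≤ 1 + x/2 := by linarith
  rcases lt_or_ge x δ with h | h
  · have := hδF ⟨hx, h⟩
    refine le_trans ?_ this
    have := Real.rpow_le_rpow_of_exponent_le hx1 ha1
    rwa [Real.rpow_one] at this
  rcases le_total x M with h' | h'
  · refine le_trans ?_ (hzm ⟨h, h'⟩)
    calc (1+x/2)^a ≤ (1+M/2)^a := by gcongr
      _ ≤ (1+M/2)^(Real.log (F z) / Real.log (1+M/2)) :=
          Real.rpow_le_rpow_of_exponent_le (by linarith) ha3
      _ = F z := by
          rw [Real.rpow_def_of_pos (by linarith), mul_div_cancel₀ _ hlM.ne',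
            Real.exp_log (by linarith)]
  · have hh := hM x h'
    refine le_trans ?_ (hi x hx)
    calc (1+x/2)^a ≤ (1+x/2)^(b/2) := Real.rpow_le_rpow_of_exponent_le hx1 ha2
      _ ≤ x^(b/2) := by
          have := hh.2.1
          gcongr
          linarith
      _ ≤ c * x^(b/2) * x^(b/2) := le_mul_of_one_le_left (by positivity) hh.1
      _ = c * x^b := by rw [mul_assoc, ← Real.rpow_add hx]; ring_nf

lemma FF_lower {ν : ℝ} (hν : 1/2 < ν) :
    ∃ a : ℝ, 0 < a ∧ ∀ x, 0 < x → (1 + x/2)^a ≤ Real.exp x * GG ν x := by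
  have hG : 0 < Real.Gamma ν := Real.Gamma_pos_of_pos (by linarith)
  refine exists_lower (b := ν - 1/2) (c := 2 * (1/2)^ν * √(π/2) / Real.Gamma ν) (by linarith)
    (by positivity)
    (Continuous.continuousOn (Real.continuous_exp.mul (GG_cont (by linarith)))) ?_ ?_ ?_
  · intro x hx
    have := GG_gt hν hx
    calc (1:ℝ) = Real.exp x * Real.exp (-x) := by rw [← Real.exp_add]; simp
      _ < _ := by gcongr
  · have h := (GG_tendsto hν).eventually (lt_mem_nhds (show (-(1/4):ℝ) < 0 by norm_num))
    have h1 : ∀ᶠ x in 𝓝[>] (0:ℝ), x < 1 := nhdsWithin_le_nhds (gt_mem_nhds one_pos)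
    filter_upwards [h, h1, self_mem_nhdsWithin] with x hx hx1 hx0
    have hx0 : 0 < x := hx0
    rw [lt_div_iff₀ hx0] at hx
    have := Real.add_one_le_exp x
    calc 1 + x/2 ≤ (x+1) * (1 - x/4) := by nlinarith
      _ ≤ _ := mul_le_mul this (by linarith) (by linarith) (by positivity)
  · intro x hx
    unfold GG
    rw [← bess_eq (by linarith) hx, ← mul_div_assoc, div_mul_eq_mul_div]
    refine div_le_div_of_nonneg_right ?_ hG.le
    have := bess_lower hν hx
    calc 2 * (1/2)^ν * √(π/2) * x^(ν-1/2)
        = Real.exp x * (2 * (x/2)^ν * (Real.exp (-x) * √(π/(2*x)))) := by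
          rw [Real.rpow_sub hx, ← Real.sqrt_eq_rpow, div_eq_mul_one_div x 2,
            Real.mul_rpow hx.le (by norm_num), ← div_div, Real.sqrt_div (x := π/2) (by positivity),
            Real.exp_neg]
          field_simp
      _ ≤ _ := by gcongr

lemma main_tendsto {ν : ℝ} (hν : 1/2 < ν) :
    Tendsto (fun n : ℝ => ∫ y in Ioi (0:ℝ), (Real.exp (y/n) * GG ν (y/n))^(-n)) atTop (𝓝 1) := by
  obtain ⟨a, ha, hlow⟩ := FF_lower hν
  rw [← integral_exp_neg_Ioi_zero]
  refine tendsto_integral_filter_of_dominated_convergence (fun y => (1 + a*y/4)^(-2:ℝ)) ?_ ?_ ?_ ?_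
  · filter_upwards [eventually_gt_atTop 0] with n hn
    refine ContinuousOn.aestronglyMeasurable ?_ measurableSet_Ioi
    refine ContinuousOn.rpow_const ?_ ?_
    · refine Continuous.continuousOn ?_
      have := GG_cont (ν := ν) (by linarith)
      fun_prop
    · intro y hy
      have hy : 0 < y := hy
      left
      have := hlow (y/n) (by positivity)
      have : 0 < (1 + y/n/2)^a := by positivity
      linarith
  · filter_upwards [eventually_ge_atTop (2/a)] with n hn
    have hn0 : 0 < n := lt_of_lt_of_le (by positivity) hn
    refine (ae_restrict_iff' measurableSet_Ioi).2 (ae_of_all _ fun y hy => ?_)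
    have hy : 0 < y := hy
    have hl := hlow (y/n) (by positivity)
    have hp : 0 < (1 + y/n/2)^a := by positivity
    have hp2 : 0 < Real.exp (y/n) * GG ν (y/n) := by linarith
    rw [Real.norm_of_nonneg (by positivity), Real.rpow_neg hp2.le, Real.rpow_neg (by positivity)]
    gcongr
    have hb := one_add_mul_self_le_rpow_one_add (s := y/n/2) (p := n*a/2)
      (by have : 0 < y/n/2 := by positivity
          linarith)
      (by rw [div_le_iff₀ ha] at hn; linarith)
    calc (1 + a*y/4)^(2:ℝ) = (1 + n*a/2 * (y/n/2))^(2:ℝ) := by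
          congr 2; field_simp; norm_num
      _ ≤ ((1 + y/n/2)^(n*a/2))^(2:ℝ) := by gcongr
      _ = ((1 + y/n/2)^a)^n := by
          rw [← Real.rpow_mul (by positivity), ← Real.rpow_mul (by positivity)]
          ring_nf
      _ ≤ _ := by gcongr
  · have h := integrableOn_add_rpow_Ioi_of_lt (a := -2) (c := 0) (m := 4/a) (by norm_num)
      (by simp; positivity)
    refine IntegrableOn.congr_fun (h.const_mul ((a/4)^(-2:ℝ))) (fun y hy => ?_) measurableSet_Ioi
    have hy : 0 < y := hy
    beta_reduce
    rw [← Real.mul_rpow (by positivity) (by positivity)]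
    congr 1
    field_simp
    ring
  · refine (ae_restrict_iff' measurableSet_Ioi).2 (ae_of_all _ fun y hy => ?_)
    have hy : 0 < y := hy
    have ht : Tendsto (fun n : ℝ => y/n) atTop (𝓝[>] 0) := by
      refine tendsto_nhdsWithin_iff.2 ⟨tendsto_const_nhds.div_atTop tendsto_id, ?_⟩
      filter_upwards [eventually_gt_atTop 0] with n hn
      exact div_pos hy hn
    have h1 : Tendsto (fun n : ℝ => n * (GG ν (y/n) - 1)) atTop (𝓝 0) := by
      have := ((GG_tendsto hν).comp ht).const_mul y
      rw [mul_zero] at this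
      refine this.congr' ?_
      filter_upwards [eventually_gt_atTop 0] with n hn
      simp only [Function.comp]
      field_simp
    have h2 := Real.tendsto_one_add_rpow_exp_of_tendsto h1
    rw [Real.exp_zero] at h2
    have h3 := (h2.inv₀ one_ne_zero).const_mul (Real.exp (-y))
    rw [inv_one, mul_one] at h3
    refine h3.congr' ?_
    filter_upwards [eventually_gt_atTop 0] with n hn
    have hg : 0 < GG ν (y/n) := (Real.exp_pos _).trans (GG_gt hν (by positivity))
    rw [add_sub_cancel, Real.mul_rpow (Real.exp_pos _).le hg.le, Real.rpow_neg hg.le,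
      ← Real.exp_mul]
    congr 2
    field_simp

end BesselAux

theorem ball_besselK_asymptotics {ν : ℝ} (hν : 1/2 < ν) :
    (fun n : ℝ =>
        (∫ x in Set.Ioi (0 : ℝ),
            (2 * Real.exp x * (x / 2) ^ ν * besselK ν x / Real.Gamma ν) ^ (-n)) -
          1 / n)
      =o[atTop] fun n : ℝ => 1 / n := by
  have hne : ∀ᶠ n : ℝ in atTop, 1 / n = 0 → (∫ x in Set.Ioi (0 : ℝ),
            (2 * Real.exp x * (x / 2) ^ ν * besselK ν x / Real.Gamma ν) ^ (-n)) - 1 / n = 0 := by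
    filter_upwards [eventually_gt_atTop 0] with n hn h
    exact absurd h (by positivity)
  rw [isLittleO_iff_tendsto' hne]
  have h := (main_tendsto hν).sub_const 1
  rw [sub_self] at h
  refine h.congr' ?_
  filter_upwards [eventually_gt_atTop 0] with n hn
  have e : (∫ x in Set.Ioi (0 : ℝ),
      (2 * Real.exp x * (x / 2) ^ ν * besselK ν x / Real.Gamma ν) ^ (-n)) =
      ∫ x in Set.Ioi (0 : ℝ), (Real.exp x * GG ν x) ^ (-n) := by
    refine MeasureTheory.setIntegral_congr_fun measurableSet_Ioi fun x hx => ?_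
    have hx : 0 < x := hx
    beta_reduce
    unfold GG
    rw [← bess_eq (by linarith) hx]
    congr 1
    ring
  rw [e]
  have hs := MeasureTheory.integral_comp_mul_left_Ioi
    (fun x : ℝ => (Real.exp x * GG ν x) ^ (-n)) 0 (inv_pos.2 hn)
  simp only [mul_zero, inv_inv, smul_eq_mul] at hs
  simp only [div_eq_inv_mul]
  rw [hs]
  field_simp
end

section
/- For 0 < ν < 1 non-integer, as x → 0⁺, 2(x/2)^ν K_ν(x)/Γ(ν) = 1 + x²/(4(1-ν)) + (Γ(-ν)/Γ(ν))(x/2)^{2ν} + O(x^{2+2ν}). -/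
open Real Filter Asymptotics

open MeasureTheory

theorem integ_aux {f : ℝ → ℝ} {a b : ℝ} (hf : Measurable f) (ha : -1 < a) (hb : b < -1)
    (h0 : ∀ s, 0 < s → |f s| ≤ s ^ a) (h1 : ∀ s, 0 < s → |f s| ≤ s ^ b) :
    IntegrableOn f (Set.Ioi 0) := by
  rw [← Set.Ioc_union_Ioi_eq_Ioi (zero_le_one' ℝ)]
  refine IntegrableOn.union ?_ ?_
  · have := (intervalIntegrable_iff_integrableOn_Ioc_of_le (zero_le_one' ℝ)).1
      (intervalIntegral.intervalIntegrable_rpow' (a := 0) (b := 1) ha)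
    refine Integrable.mono' this hf.aestronglyMeasurable ?_
    exact ae_restrict_of_forall_mem measurableSet_Ioc fun s hs => h0 s hs.1
  · refine Integrable.mono' (integrableOn_Ioi_rpow_of_lt hb zero_lt_one) hf.aestronglyMeasurable ?_
    exact ae_restrict_of_forall_mem measurableSet_Ioi fun s hs => 
      h1 s (zero_lt_one.trans hs)

/-- `0 ≤ 1 - e^{-s} ≤ min(1,s)` -/
theorem one_sub_exp_bounds {s : ℝ} (hs : 0 < s) :
    0 ≤ 1 - exp (-s) ∧ 1 - exp (-s) ≤ s ∧ 1 - exp (-s) ≤ 1 := by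
  have h1 := Real.one_sub_le_exp_neg s
  have h2 : exp (-s) ≤ 1 := Real.exp_le_one_iff.2 (by linarith)
  have h3 := Real.exp_pos (-s)
  refine ⟨by linarith, by linarith, by linarith⟩

theorem exp_quad {s : ℝ} (hs : 0 < s) : exp (-s) - 1 + s ≤ s ^ 2 := by
  -- e^{-s} ≤ 1/(1+s)
  have h : exp (-s) ≤ 1 / (1 + s) := by
    rw [Real.exp_neg, ← one_div]
    apply one_div_le_one_div_of_le (by linarith)
    linarith [Real.add_one_le_exp s]
  have h2 : 1 / (1 + s) ≤ 1 - s + s ^ 2 := by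
    rw [div_le_iff₀ (by linarith)]
    nlinarith [pow_pos hs 3]
  linarith

theorem integrable_one_sub_exp {μ : ℝ} (h0 : 0 < μ) (h1 : μ < 1) :
    IntegrableOn (fun s : ℝ => (1 - exp (-s)) * s ^ (-μ - 1)) (Set.Ioi 0) := by
  refine integ_aux (a := -μ) (b := -μ - 1) (by fun_prop) (by linarith) (by linarith) ?_ ?_
  · intro s hs
    obtain ⟨ha, hb, hc⟩ := one_sub_exp_bounds hs
    have hp : 0 < s ^ (-μ - 1) := by positivity
    rw [abs_of_nonneg (by positivity)]
    calc _ ≤ s * s ^ (-μ - 1) := by gcongr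
      _ = s ^ (-μ) := by
        rw [Real.rpow_sub_one hs.ne']; field_simp
  · intro s hs
    obtain ⟨ha, hb, hc⟩ := one_sub_exp_bounds hs
    have hp : 0 < s ^ (-μ - 1) := by positivity
    rw [abs_of_nonneg (by positivity)]
    calc _ ≤ 1 * s ^ (-μ - 1) := by gcongr
      _ = _ := one_mul _

theorem integral_one_sub_exp {μ : ℝ} (h0 : 0 < μ) (h1 : μ < 1) :
    ∫ s in Set.Ioi (0 : ℝ), (1 - exp (-s)) * s ^ (-μ - 1) = - Gamma (-μ) := by
  have hG := Real.GammaIntegral_convergent (s := 1 - μ) (by linarith)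
  have hGe := Real.Gamma_eq_integral (s := 1 - μ) (by linarith)
  have key := integral_Ioi_mul_deriv_eq_deriv_mul (a := 0) (a' := 0) (b' := 0)
    (u := fun s : ℝ => 1 - exp (-s)) (u' := fun s => exp (-s))
    (v := fun s : ℝ => s ^ (-μ)) (v' := fun s => -μ * s ^ (-μ - 1)) ?_ ?_ ?_ ?_ ?_ ?_
  · have e1 : ∫ s in Set.Ioi (0 : ℝ), (1 - exp (-s)) * (-μ * s ^ (-μ - 1))
        = -μ * ∫ s in Set.Ioi (0 : ℝ), (1 - exp (-s)) * s ^ (-μ - 1) := by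
      rw [← integral_const_mul]; congr 1; ext s; ring
    have e2 : ∫ s in Set.Ioi (0 : ℝ), exp (-s) * s ^ (-μ) = Gamma (1 - μ) := by
      rw [hGe]; congr 1; ext s; ring_nf
    rw [e1, e2] at key
    have e3 := Real.Gamma_add_one (s := -μ) (by linarith)
    rw [show -μ + 1 = 1 - μ by ring] at e3
    rw [e3] at key
    have : μ * (∫ s in Set.Ioi (0 : ℝ), (1 - exp (-s)) * s ^ (-μ - 1)) = μ * (-Gamma (-μ)) := by
      linarith
    exact mul_left_cancel₀ h0.ne' this
  · intro s hs
    have := ((hasDerivAt_neg s).exp).const_sub 1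
    simpa using this
  · intro s hs
    exact Real.hasDerivAt_rpow_const (Or.inl (ne_of_gt hs))
  · refine ((integrable_one_sub_exp h0 h1).const_mul (-μ)).congr ?_
    exact Eventually.of_forall fun s => by simp [Pi.mul_apply]; ring
  · refine hG.congr (Eventually.of_forall fun s => ?_)
    simp only [Pi.mul_apply]; ring_nf
  · have : Tendsto (fun s : ℝ => s ^ (1 - μ)) (nhdsWithin 0 (Set.Ioi 0)) (nhds 0) := by
      have := (Real.continuousAt_rpow_const 0 (1 - μ) (Or.inr (by linarith))).tendsto
      rw [Real.zero_rpow (by linarith)] at this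
      exact this.mono_left nhdsWithin_le_nhds
    refine squeeze_zero' ?_ ?_ this
    · filter_upwards [self_mem_nhdsWithin] with s hs
      have hs : 0 < s := hs
      obtain ⟨ha, hb, hc⟩ := one_sub_exp_bounds hs
      simp only [Pi.mul_apply]; positivity
    · filter_upwards [self_mem_nhdsWithin] with s hs
      have hs : 0 < s := hs
      obtain ⟨ha, hb, hc⟩ := one_sub_exp_bounds hs
      simp only [Pi.mul_apply]
      rw [sub_eq_add_neg 1 μ, Real.rpow_add hs, Real.rpow_one]
      gcongr
  · refine squeeze_zero' ?_ ?_ (tendsto_rpow_neg_atTop h0)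
    · filter_upwards [eventually_gt_atTop 0] with s hs
      obtain ⟨ha, hb, hc⟩ := one_sub_exp_bounds hs
      simp only [Pi.mul_apply]; positivity
    · filter_upwards [eventually_gt_atTop 0] with s hs
      obtain ⟨ha, hb, hc⟩ := one_sub_exp_bounds hs
      simp only [Pi.mul_apply]
      calc _ ≤ 1 * s ^ (-μ) := by gcongr
        _ = _ := one_mul _

theorem subst_aux (f : ℝ → ℝ) {z : ℝ} (hz : 0 < z) (a : ℝ)
    (hf : IntegrableOn (fun u => f u * u ^ (-a - 1)) (Set.Ioi 0)) :
    IntegrableOn (fun s => f (z / s) * s ^ (a - 1)) (Set.Ioi 0) ∧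
    ∫ s in Set.Ioi (0 : ℝ), f (z / s) * s ^ (a - 1)
      = z ^ a * ∫ u in Set.Ioi (0 : ℝ), f u * u ^ (-a - 1) := by
  set g : ℝ → ℝ := fun u => f u * u ^ (-a - 1) with hg
  have hza : z ^ a * z ^ (-a - 1) * z = 1 := by
    rw [← Real.rpow_add hz, ← Real.rpow_add_one hz.ne']; ring_nf; simp
  have hpt : Set.EqOn (fun s => f (z / s) * s ^ (a - 1)) (fun s : ℝ =>
      z ^ a * z * ((|(-1 : ℝ)| * s ^ ((-1 : ℝ) - 1)) • g (z * s ^ (-1 : ℝ)))) (Set.Ioi 0) := by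
    intro s hs
    have hs : 0 < s := hs
    simp only [hg, smul_eq_mul, abs_neg, abs_one, one_mul]
    rw [Real.mul_rpow hz.le (by positivity), ← Real.rpow_mul hs.le, Real.rpow_neg_one,
      ← div_eq_mul_inv]
    have : s ^ ((-1 : ℝ) - 1) * s ^ (-1 * (-a - 1)) = s ^ (a - 1) := by
      rw [← Real.rpow_add hs]; ring_nf
    calc _ = f (z / s) * (s ^ ((-1 : ℝ) - 1) * s ^ (-1 * (-a - 1))) * (z ^ a * z ^ (-a - 1) * z) := by
          rw [this, hza, mul_one]
      _ = _ := by ring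
  have hi1 : IntegrableOn (fun u => g (z * u)) (Set.Ioi 0) := by
    rw [integrableOn_Ioi_comp_mul_left_iff g 0 hz, mul_zero]; exact hf
  have hi2 := (integrableOn_Ioi_comp_rpow_iff (fun u => g (z * u)) (p := -1) (by norm_num)).2 hi1
  refine ⟨(integrableOn_congr_fun hpt measurableSet_Ioi).2 (hi2.const_mul _), ?_⟩
  rw [setIntegral_congr_fun measurableSet_Ioi hpt, integral_const_mul,
    integral_comp_rpow_Ioi (fun u => g (z * u)) (p := -1) (by norm_num),
    integral_comp_mul_left_Ioi g 0 hz, mul_zero, smul_eq_mul]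
  field_simp

theorem integrable_quad {ν : ℝ} (h0 : 0 < ν) (h1 : ν < 1) :
    IntegrableOn (fun s : ℝ => (exp (-s) - 1 + s) * s ^ (-(ν + 1) - 1)) (Set.Ioi 0) := by
  refine integ_aux (a := -ν) (b := -ν - 1) (by fun_prop) (by linarith) (by linarith) ?_ ?_
  · intro s hs
    obtain ⟨ha, hb, hc⟩ := one_sub_exp_bounds hs
    have hp : 0 ≤ exp (-s) - 1 + s := by linarith
    rw [abs_of_nonneg (by positivity)]
    calc _ ≤ s ^ 2 * s ^ (-(ν + 1) - 1) := by gcongr; exact exp_quad hs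
      _ = s ^ (-ν) := by
        rw [← Real.rpow_two, ← Real.rpow_add hs]; ring_nf
  · intro s hs
    obtain ⟨ha, hb, hc⟩ := one_sub_exp_bounds hs
    have hp : 0 ≤ exp (-s) - 1 + s := by linarith
    rw [abs_of_nonneg (by positivity)]
    calc _ ≤ s * s ^ (-(ν + 1) - 1) := by gcongr; linarith
      _ = s ^ (-ν - 1) := by
        nth_rw 1 [← Real.rpow_one s]
        rw [← Real.rpow_add hs]; ring_nf

theorem F_expansion {ν : ℝ} (h0 : 0 < ν) (h1 : ν < 1) {z : ℝ} (hz : 0 < z) :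
    IntegrableOn (fun s : ℝ => exp (-s - z / s) * s ^ (ν - 1)) (Set.Ioi 0) ∧
    |(∫ s in Set.Ioi (0 : ℝ), exp (-s - z / s) * s ^ (ν - 1)) -
      (Gamma ν + z ^ ν * Gamma (-ν) + z * (Gamma ν / (1 - ν)))|
      ≤ z ^ (ν + 1) *
        ∫ u in Set.Ioi (0 : ℝ), (exp (-u) - 1 + u) * u ^ (-(ν + 1) - 1) := by
  have iA := Real.GammaIntegral_convergent h0
  have eA := Real.Gamma_eq_integral h0
  obtain ⟨iB, eB⟩ := subst_aux (fun u => 1 - exp (-u)) hz ν (integrable_one_sub_exp h0 h1)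
  rw [integral_one_sub_exp h0 h1] at eB
  have iC := integrable_one_sub_exp (μ := 1 - ν) (by linarith) (by linarith)
  have eC := integral_one_sub_exp (μ := 1 - ν) (by linarith) (by linarith)
  obtain ⟨iG, eG⟩ := subst_aux (fun u => exp (-u) - 1 + u) hz (ν + 1) (integrable_quad h0 h1)
  have hbd : ∀ s ∈ Set.Ioi (0 : ℝ),
      ‖(exp (-(z / s)) - 1 + z / s) * (exp (-s) - 1) * s ^ (ν - 1)‖
        ≤ (exp (-(z / s)) - 1 + z / s) * s ^ (ν + 1 - 1) := by
    intro s hs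
    have hs : 0 < s := hs
    obtain ⟨ha, hb, hc⟩ := one_sub_exp_bounds hs
    obtain ⟨ha', hb', hc'⟩ := one_sub_exp_bounds (div_pos hz hs)
    have hp : 0 ≤ exp (-(z / s)) - 1 + z / s := by linarith
    rw [norm_mul, norm_mul, Real.norm_of_nonneg hp,
      Real.norm_of_nonneg (Real.rpow_nonneg hs.le _), mul_assoc]
    gcongr
    have : s ^ (ν + 1 - 1) = s * s ^ (ν - 1) := by
      rw [add_sub_cancel_right, Real.rpow_sub_one hs.ne']; field_simp
    rw [this]
    gcongr
    rw [Real.norm_eq_abs, abs_le]; constructor <;> linarith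
  have iD : IntegrableOn (fun s : ℝ => (exp (-(z / s)) - 1 + z / s) * (exp (-s) - 1) * s ^ (ν - 1))
      (Set.Ioi 0) := by
    refine Integrable.mono' iG (Measurable.aestronglyMeasurable (by fun_prop)) ?_
    exact ae_restrict_of_forall_mem measurableSet_Ioi hbd
  have eD := norm_integral_le_of_norm_le iG (ae_restrict_of_forall_mem measurableSet_Ioi hbd)
  rw [eG] at eD
  have hpt : Set.EqOn (fun s : ℝ => exp (-s - z / s) * s ^ (ν - 1)) (fun s =>
      ((exp (-s) * s ^ (ν - 1) - (1 - exp (-(z / s))) * s ^ (ν - 1))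
        + z * ((1 - exp (-s)) * s ^ (-(1 - ν) - 1)))
        + (exp (-(z / s)) - 1 + z / s) * (exp (-s) - 1) * s ^ (ν - 1)) (Set.Ioi 0) := by
    intro s hs
    have hs : 0 < s := hs
    have e1 : s ^ (-(1 - ν) - 1) = s ^ (ν - 1) / s := by
      rw [Real.rpow_sub_one hs.ne']; ring_nf
    simp only
    rw [e1, sub_eq_add_neg (-s), Real.exp_add]
    field_simp
    ring
  have i1 := iA.sub iB
  have i2 := i1.add (iC.const_mul z)
  have i3 := i2.add iD
  refine ⟨(integrableOn_congr_fun hpt measurableSet_Ioi).2 i3, ?_⟩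
  have hsum : (∫ s in Set.Ioi (0 : ℝ), exp (-s - z / s) * s ^ (ν - 1)) =
      Gamma ν - z ^ ν * (- Gamma (-ν)) + z * (- Gamma (-(1 - ν))) +
      ∫ s in Set.Ioi (0 : ℝ), (exp (-(z / s)) - 1 + z / s) * (exp (-s) - 1) * s ^ (ν - 1) := by
    rw [setIntegral_congr_fun measurableSet_Ioi hpt]
    rw [← eA.symm, ← eB, ← eC, ← integral_const_mul z]
    have t3 := integral_add' i2 iD
    rw [integral_add' i1 (iC.const_mul z), integral_sub' iA iB] at t3
    exact t3
  have hGam : - Gamma (-(1 - ν)) = Gamma ν / (1 - ν) := by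
    have e3 := Real.Gamma_add_one (s := -(1 - ν)) (by linarith)
    rw [show -(1 - ν) + 1 = ν by ring] at e3
    rw [eq_div_iff (by linarith), e3]; ring
  rw [hsum, hGam]
  rw [Real.norm_eq_abs] at eD
  convert eD using 2
  ring

theorem besselK_eq {ν x : ℝ} (hx : 0 < x)
    (hi : IntegrableOn (fun s : ℝ => exp (-s - (x / 2) ^ 2 / s) * s ^ (ν - 1)) (Set.Ioi 0)) :
    2 * (x / 2) ^ ν * (∫ t in Set.Ioi (0 : ℝ), Real.exp (-x * Real.cosh t) * Real.cosh (ν * t)) =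
      ∫ s in Set.Ioi (0 : ℝ), exp (-s - (x / 2) ^ 2 / s) * s ^ (ν - 1) := by
  set y := x / 2 with hy
  have hy0 : 0 < y := by positivity
  have himg : (fun t : ℝ => y * exp t) '' Set.univ = Set.Ioi 0 := by
    ext s
    simp only [Set.image_univ, Set.mem_range, Set.mem_Ioi]
    constructor
    · rintro ⟨t, rfl⟩; positivity
    · intro hs
      exact ⟨Real.log (s / y), by rw [Real.exp_log (by positivity)]; field_simp⟩
  have hd : ∀ t ∈ (Set.univ : Set ℝ), HasDerivWithinAt (fun t : ℝ => y * exp t) (y * exp t) Set.univ t :=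
    fun t _ => ((Real.hasDerivAt_exp t).const_mul y).hasDerivWithinAt
  have hinj : Set.InjOn (fun t : ℝ => y * exp t) Set.univ := by
    intro a _ b _ hab
    exact Real.exp_injective (mul_left_cancel₀ hy0.ne' hab)
  set h : ℝ → ℝ := fun t => y ^ ν * (exp (-x * cosh t) * exp (ν * t)) with hh
  have hpt : ∀ t : ℝ, |y * exp t| • (exp (-(y * exp t) - y ^ 2 / (y * exp t)) * (y * exp t) ^ (ν - 1))
      = h t := by
    intro t
    have hp : 0 < y * exp t := by positivity
    rw [abs_of_pos hp, smul_eq_mul, Real.rpow_sub_one hp.ne', Real.mul_rpow hy0.le (exp_pos t).le,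
      ← Real.exp_mul, hh]
    have e1 : -(y * exp t) - y ^ 2 / (y * exp t) = -x * cosh t := by
      rw [Real.cosh_eq, Real.exp_neg, show x = 2 * y by rw [hy]; ring]
      field_simp
      ring
    rw [e1, mul_comm t ν]
    field_simp
  have hint : Integrable h := by
    have := (integrableOn_image_iff_integrableOn_abs_deriv_smul MeasurableSet.univ hd hinj
      (fun s : ℝ => exp (-s - y ^ 2 / s) * s ^ (ν - 1))).1 (by rw [himg]; exact hi)
    rw [integrableOn_univ] at this
    exact this.congr (Eventually.of_forall hpt)
  have heq := integral_image_eq_integral_abs_deriv_smul MeasurableSet.univ hd hinj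
      (fun s : ℝ => exp (-s - y ^ 2 / s) * s ^ (ν - 1))
  rw [himg, Measure.restrict_univ] at heq
  simp only [hpt] at heq
  have hneg : ∫ t, h (-t) = ∫ t, h t := integral_neg_eq_self h volume
  have hadd : ∫ t, (h t + h (-t)) = 2 * ∫ t, h t := by
    rw [integral_add hint hint.comp_neg, hneg]; ring
  have habs := integral_comp_abs (f := fun t => exp (-x * cosh t) * cosh (ν * t))
  have hpt2 : ∀ t, h t + h (-t) = 2 * y ^ ν * (exp (-x * cosh |t|) * cosh (ν * |t|)) := by
    intro t
    have : cosh (ν * |t|) = cosh (ν * t) := by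
      rcases abs_cases t with ⟨h, _⟩ | ⟨h, _⟩ <;> rw [h]
      rw [mul_neg, Real.cosh_neg]
    rw [this, Real.cosh_abs, hh]
    simp only [Real.cosh_neg]
    rw [Real.cosh_eq (ν * t)]
    ring_nf
  simp only [hpt2] at hadd
  rw [integral_const_mul, habs] at hadd
  rw [heq]
  linarith

theorem besselK_small_x_expansion {ν : ℝ} (hν0 : 0 < ν) (hν1 : ν < 1) :
    (fun x : ℝ =>
        2 * (x / 2) ^ ν * besselK ν x / Real.Gamma ν -
          (1 + x ^ 2 / (4 * (1 - ν)) +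
            (Real.Gamma (-ν) / Real.Gamma ν) * (x / 2) ^ (2 * ν)))
      =O[nhdsWithin 0 (Set.Ioi 0)] fun x : ℝ => x ^ (2 + 2 * ν) := by
  have hG : 0 < Gamma ν := Real.Gamma_pos_of_pos hν0
  set I : ℝ := ∫ u in Set.Ioi (0 : ℝ), (exp (-u) - 1 + u) * u ^ (-(ν + 1) - 1)
  refine IsBigO.of_bound ((1 / 2) ^ (2 + 2 * ν) * I / Gamma ν) ?_
  filter_upwards [self_mem_nhdsWithin] with x hx
  have hx : 0 < x := hx
  have hy : 0 < x / 2 := by positivity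
  obtain ⟨hi, hb⟩ := F_expansion hν0 hν1 (z := (x / 2) ^ 2) (by positivity)
  have hK := besselK_eq hx hi
  rw [← hK] at hb
  change |2 * (x / 2) ^ ν * besselK ν x - _| ≤ _ * I at hb
  have e1 : ((x / 2) ^ 2) ^ ν = (x / 2) ^ (2 * ν) := by
    rw [← Real.rpow_two, ← Real.rpow_mul hy.le]
  have e2 : ((x / 2) ^ 2) ^ (ν + 1) = (1 / 2) ^ (2 + 2 * ν) * x ^ (2 + 2 * ν) := by
    rw [← Real.rpow_two, ← Real.rpow_mul hy.le, ← Real.mul_rpow (by norm_num) hx.le]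
    ring_nf
  rw [e1, e2] at hb
  have h1ν : (1 - ν) ≠ 0 := by linarith
  have e3 : 2 * (x / 2) ^ ν * besselK ν x / Real.Gamma ν -
          (1 + x ^ 2 / (4 * (1 - ν)) +
            (Real.Gamma (-ν) / Real.Gamma ν) * (x / 2) ^ (2 * ν)) =
      (2 * (x / 2) ^ ν * besselK ν x - (Gamma ν + (x / 2) ^ (2 * ν) * Gamma (-ν) +
        (x / 2) ^ 2 * (Gamma ν / (1 - ν)))) / Gamma ν := by
    field_simp
    ring
  rw [e3, Real.norm_eq_abs, abs_div, abs_of_pos hG, Real.norm_of_nonneg (by positivity),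
    div_le_iff₀ hG]
  refine hb.trans (le_of_eq ?_)
  field_simp
end

section
/- Let m ≥ 1, σ_1,…,σ_m > -1, and μ_k = ∏_{j=1}^m (σ_j + k)^{-1}. Then the first positive zero j_{σ,1} of the hyper-Bessel function J_{σ_1,…,σ_m} satisfies (m+1) μ_1^{-1/(m+1)} < j_{σ,1} < (m+1)(μ_1 - μ_2)^{-1/(m+1)}. -/
open Real

/-- The normalised hyper-Bessel hypergeometric series
`₀F_m(—; σ_1+1,…,σ_m+1; -(x/(m+1))^{m+1})`. -/
noncomputable def hyperF (m : ℕ) (σ : Fin m → ℝ) (x : ℝ) : ℝ :=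
  ∑' k : ℕ, (-(x / (m + 1)) ^ (m + 1)) ^ k /
    ((∏ j, Real.Gamma (σ j + 1 + k) / Real.Gamma (σ j + 1)) * k.factorial)

/-- The hyper-Bessel function `J_{σ_1,…,σ_m}`. -/
noncomputable def hyperBessel (m : ℕ) (σ : Fin m → ℝ) (x : ℝ) : ℝ :=
  (x / (m + 1)) ^ (∑ j, σ j) / (∏ j, Real.Gamma (σ j + 1)) * hyperF m σ x

open MeasureTheory in
theorem hb_core {Ω : Type*} [MeasurableSpace Ω] (P : Measure Ω) [IsProbabilityMeasure P]
    (T : Ω → ℝ) (hTm : Measurable T) (hT0 : ∀ w, 0 ≤ T w) (hT1 : ∀ w, T w ≤ 1)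
    (M a : ℕ → ℝ) (hM0 : 0 < M 0) (hMom : ∀ k, ∫ w, T w ^ k ∂P = M k / M 0)
    (hM1 : M 1 < M 0) (hM1' : 0 < M 1)
    (ha0 : a 0 = 1) (ha : ∀ k, a (k + 1) * (k + 1) = M k * a k)
    (z : ℝ) (hz : 0 < z) (hzero : ∑' k, a k * (-z) ^ k = 0)
    (hfirst : ∀ y ∈ Set.Ioo 0 z, ∑' k, a k * (-y) ^ k ≠ 0) :
    1 < M 0 * z ∧ z * (M 0 - M 1) < 1 := by
  have hTint : ∀ k, Integrable (fun w => T w ^ k) P := by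
    intro k
    refine Integrable.of_bound (C := 1) (hTm.pow_const k).aestronglyMeasurable ?_
    filter_upwards with w
    rw [norm_pow, Real.norm_eq_abs, abs_of_nonneg (hT0 w)]
    exact pow_le_one₀ (hT0 w) (hT1 w)
  have hMn : ∀ k, 0 ≤ M k := by
    intro k
    have h : 0 ≤ ∫ w, T w ^ k ∂P := integral_nonneg (fun w => pow_nonneg (hT0 w) k)
    rw [hMom, le_div_iff₀ hM0] at h
    simpa using h
  have hMle : ∀ k, M k ≤ M 0 := by
    intro k
    have h : ∫ w, T w ^ k ∂P ≤ ∫ w, (1 : ℝ) ∂P :=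
      integral_mono (hTint k) (integrable_const _) (fun w => pow_le_one₀ (hT0 w) (hT1 w))
    rw [hMom, div_le_iff₀ hM0] at h
    simpa using h
  have hab : ∀ k, 0 ≤ a k ∧ a k ≤ M 0 ^ k / k.factorial := by
    intro k
    induction k with
    | zero => simp [ha0]
    | succ k ih =>
      have e : a (k + 1) = M k * a k / (k + 1) := by
        rw [← ha k]; field_simp
      rw [e]
      constructor
      · have := hMn k
        have := ih.1
        positivity
      · have e2 : M 0 ^ (k + 1) / ((k + 1).factorial : ℝ)
          = M 0 * (M 0 ^ k / k.factorial) / (k + 1) := by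
          rw [Nat.factorial_succ]; push_cast; field_simp; ring
        rw [e2]
        gcongr
        · exact ih.1
        · exact hMle k
        · exact ih.2
  have hsumabs : ∀ R : ℝ, 0 ≤ R → Summable (fun k => a k * R ^ k) := by
    intro R hR
    refine Summable.of_nonneg_of_le (fun k => mul_nonneg (hab k).1 (pow_nonneg hR k)) ?_
      (Real.summable_pow_div_factorial (M 0 * R))
    intro k
    rw [mul_pow, mul_div_right_comm]
    gcongr
    exact (hab k).2
  set F : ℝ → ℝ := fun y => ∑' k, a k * (-y) ^ k with hF
  set G : ℝ → ℝ := fun y => ∫ w, F (T w * y) ∂P with hG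
  have hGs : ∀ y, G y = ∑' k, a k * (M k / M 0) * (-y) ^ k := by
    intro y
    have hb : ∀ k w, ‖a k * (-(T w * y)) ^ k‖ ≤ a k * |y| ^ k := by
      intro k w
      rw [norm_mul, norm_pow, norm_neg, norm_mul, Real.norm_eq_abs, Real.norm_eq_abs,
        Real.norm_eq_abs, abs_of_nonneg (hab k).1, abs_of_nonneg (hT0 w)]
      have := (hab k).1
      gcongr
      · exact mul_nonneg (hT0 w) (abs_nonneg y)
      · exact mul_le_of_le_one_left (abs_nonneg y) (hT1 w)
    have hi : ∀ k, Integrable (fun w => a k * (-(T w * y)) ^ k) P := by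
      intro k
      refine Integrable.of_bound (C := a k * |y| ^ k) ?_ (Filter.Eventually.of_forall (hb k))
      exact (((hTm.mul_const y).neg.pow_const k).const_mul _).aestronglyMeasurable
    have := hasSum_integral_of_summable_integral_norm (μ := P)
      (F := fun k w => a k * (-(T w * y)) ^ k) hi ?_
    · rw [hG]
      simp only [hF]
      rw [← this.tsum_eq]
      congr 1
      ext k
      have : ∀ w, a k * (-(T w * y)) ^ k = (a k * (-y) ^ k) * T w ^ k := by
        intro w
        rw [← mul_neg, mul_pow]; ring
      simp_rw [this]
      rw [integral_const_mul, hMom]; ring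
    · refine Summable.of_nonneg_of_le (fun k => integral_nonneg (fun w => norm_nonneg _)) ?_
        (hsumabs |y| (abs_nonneg y))
      intro k
      have := integral_mono (hi k).norm (integrable_const (μ := P) (a k * |y| ^ k)) (hb k)
      simpa using this
  have hder : ∀ y, HasDerivAt F (-(M 0 * G y)) y := by
    intro y
    set R := |y| + 1 with hR
    have hR0 : 0 ≤ R := by positivity
    have key := hasDerivAt_tsum_of_isPreconnected (𝕜 := ℝ)
      (u := fun k : ℕ => a k * (k * R ^ (k - 1)))
      (g := fun (k : ℕ) (y : ℝ) => a k * (-y) ^ k)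
      (g' := fun (k : ℕ) (y : ℝ) => a k * (k * (-y) ^ (k - 1) * (-1)))
      (t := Metric.ball (0 : ℝ) R) (y₀ := 0) (y := y) ?_ Metric.isOpen_ball
      (convex_ball _ _).isPreconnected ?_ ?_ ?_ ?_ ?_
    · suffices hv : -(M 0 * G y) = ∑' n : ℕ, a n * (n * (-y) ^ (n - 1) * (-1)) by
        rw [hv]; exact key
      rw [Summable.tsum_eq_zero_add, hGs, ← tsum_mul_left, ← tsum_neg]
      · simp only [Nat.cast_zero, zero_mul, mul_zero, zero_add]
        congr 1
        ext k
        simp only [Nat.add_sub_cancel]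
        have e : M 0 * (a k * (M k / M 0) * (-y) ^ k) = M k * a k * (-y) ^ k := by
          field_simp
        rw [e, ← ha k]; push_cast; ring
      · rw [← summable_nat_add_iff 1]
        refine Summable.of_norm_bounded (g := fun k => M 0 * (a k * |y| ^ k))
          ((hsumabs |y| (abs_nonneg y)).mul_left _) ?_
        intro k
        have e : a (k+1) * (((k + 1 : ℕ) : ℝ) * (-y) ^ (k + 1 - 1) * (-1))
          = - (M k * a k) * (-y) ^ k := by
          rw [← ha k]; rw [Nat.add_sub_cancel]; push_cast; ring
        rw [e, norm_mul, norm_neg, norm_pow, norm_neg, norm_mul, Real.norm_eq_abs,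
          Real.norm_eq_abs, Real.norm_eq_abs, abs_of_nonneg (hMn k), abs_of_nonneg (hab k).1,
          mul_assoc]
        have := (hab k).1
        gcongr
        exact hMle k
    · rw [← summable_nat_add_iff 1]
      refine Summable.of_nonneg_of_le ?_ ?_ ((hsumabs R hR0).mul_left (M 0))
      · intro k
        have := (hab (k+1)).1
        positivity
      · intro k
        have e : a (k+1) * (((k + 1 : ℕ) : ℝ) * R ^ (k + 1 - 1)) = M k * (a k * R ^ k) := by
          rw [← mul_assoc (M k), ← ha k, Nat.add_sub_cancel]; push_cast; ring
        rw [e]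
        have := (hab k).1
        gcongr
        exact hMle k
    · intro k x _
      exact (((hasDerivAt_id x).neg.pow k).const_mul (a k)) 
    · intro k x hx
      have hx' : |x| ≤ R := by simpa using (Metric.mem_ball.1 hx).le
      rw [norm_mul, norm_mul, norm_mul, norm_pow, norm_neg, norm_neg, norm_one, mul_one,
        Real.norm_eq_abs, Real.norm_eq_abs, Real.norm_eq_abs, abs_of_nonneg (hab k).1, Nat.abs_cast]
      have := (hab k).1
      gcongr
    · exact Metric.mem_ball_self (by positivity)
    · refine summable_of_ne_finset_zero (s := {0}) ?_
      intro k hk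
      have : k ≠ 0 := by simpa using hk
      simp [this]
    · simp [hR]
  have hcont : Continuous F := continuous_iff_continuousAt.2 fun y => (hder y).continuousAt
  have hFz : F z = 0 := hzero
  have hF0 : F 0 = 1 := by
    simp only [hF]
    rw [tsum_eq_single 0]
    · simp [ha0]
    · intro k hk; simp [hk]
  have hFpos : ∀ y ∈ Set.Ico 0 z, 0 < F y := by
    intro y hy
    by_contra hneg
    push Not at hneg
    obtain ⟨c, hc, hc0⟩ := intermediate_value_Icc' hy.1 hcont.continuousOn
      (show (0 : ℝ) ∈ Set.Icc (F y) (F 0) from ⟨hneg, by rw [hF0]; norm_num⟩)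
    have : c ≠ 0 := by rintro rfl; rw [hF0] at hc0; norm_num at hc0
    exact hfirst c ⟨lt_of_le_of_ne hc.1 this.symm, hc.2.trans_lt hy.2⟩ hc0
  have hFnn : ∀ y ∈ Set.Icc 0 z, 0 ≤ F y := by
    intro y hy
    rcases hy.2.eq_or_lt with h | h
    · rw [h, hFz]
    · exact (hFpos y ⟨hy.1, h⟩).le
  have hTE : ∫ w, T w ∂P = M 1 / M 0 := by simpa using hMom 1
  have hTI : Integrable T P := by simpa using hTint 1
  have hTn1 : ¬ (∀ᵐ w ∂P, T w = 1) := by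
    intro h
    have : ∫ w, T w ∂P = ∫ w, (1 : ℝ) ∂P := integral_congr_ae h
    rw [hTE] at this
    simp at this
    rw [div_eq_one_iff_eq hM0.ne'] at this
    exact hM1.ne this
  have hTn0 : ¬ (∀ᵐ w ∂P, T w = 0) := by
    intro h
    have : ∫ w, T w ∂P = ∫ w, (0 : ℝ) ∂P := integral_congr_ae h
    rw [hTE] at this
    simp at this
    rcases this with h | h <;> linarith
  have hFint : ∀ y, Integrable (fun w => F (T w * y)) P := by
    intro y
    obtain ⟨C, hC⟩ := (isCompact_Icc (a := -|y|) (b := |y|)).exists_bound_of_continuousOn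
      hcont.continuousOn
    refine Integrable.of_bound (C := C)
      (hcont.measurable.comp (hTm.mul_const y)).aestronglyMeasurable ?_
    filter_upwards with w
    apply hC
    rw [Set.mem_Icc, ← abs_le, abs_mul, abs_of_nonneg (hT0 w)]
    exact mul_le_of_le_one_left (abs_nonneg y) (hT1 w)
  have hTmem : ∀ w, ∀ y ∈ Set.Icc 0 z, T w * y ∈ Set.Icc 0 z := fun w y hy =>
    ⟨mul_nonneg (hT0 w) hy.1, (mul_le_of_le_one_left hy.1 (hT1 w)).trans hy.2⟩
  have hGpos : ∀ y ∈ Set.Icc 0 z, 0 < G y := by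
    intro y hy
    have hnn : 0 ≤ᵐ[P] fun w => F (T w * y) :=
      Filter.Eventually.of_forall fun w => hFnn _ (hTmem w y hy)
    refine lt_of_le_of_ne (integral_nonneg_of_ae hnn) ?_
    intro h
    have h2 := (integral_eq_zero_iff_of_nonneg_ae hnn (hFint y)).1 h.symm
    apply hTn1
    filter_upwards [h2] with w hw
    by_contra hne
    have hlt : T w < 1 := lt_of_le_of_ne (hT1 w) hne
    have hmem := hTmem w y hy
    have : T w * y < z := by
      have := mul_le_mul_of_nonneg_left hy.2 (hT0 w)
      nlinarith
    exact (hFpos _ ⟨hmem.1, this⟩).ne' hw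
  have hFanti : StrictAntiOn F (Set.Icc 0 z) := by
    apply strictAntiOn_of_deriv_neg (convex_Icc 0 z) hcont.continuousOn
    intro x hx
    rw [(hder x).deriv]
    have := hGpos x (interior_subset hx)
    nlinarith [mul_pos hM0 this]
  have hGanti : StrictAntiOn G (Set.Icc 0 z) := by
    intro x hx y hy hxy
    rw [← sub_pos]
    have e : G x - G y = ∫ w, (F (T w * x) - F (T w * y)) ∂P :=
      (integral_sub (hFint x) (hFint y)).symm
    rw [e]
    have hnn : 0 ≤ᵐ[P] fun w => F (T w * x) - F (T w * y) :=
      Filter.Eventually.of_forall fun w => sub_nonneg.2 (hFanti.antitoneOn (hTmem w x hx)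
        (hTmem w y hy) (mul_le_mul_of_nonneg_left hxy.le (hT0 w)))
    refine lt_of_le_of_ne (integral_nonneg_of_ae hnn) ?_
    intro h
    have h2 := (integral_eq_zero_iff_of_nonneg_ae hnn ((hFint x).sub (hFint y))).1 h.symm
    apply hTn0
    filter_upwards [h2] with w hw
    by_contra hne
    have hlt : 0 < T w := lt_of_le_of_ne (hT0 w) (Ne.symm hne)
    have := hFanti (hTmem w x hx) (hTmem w y hy) (mul_lt_mul_of_pos_left hxy hlt)
    simp only [Pi.zero_apply] at hw
    linarith
  have hG0 : G 0 = 1 := by simp [hG, hF0]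
  have hMVT : ∀ s, 0 ≤ s → s < z → ∃ c ∈ Set.Ioo s z, F s = M 0 * G c * (z - s) := by
    intro s hs hsz
    obtain ⟨c, hc, h⟩ := exists_hasDerivAt_eq_slope F (fun y => -(M 0 * G y)) hsz
      hcont.continuousOn (fun x _ => hder x)
    refine ⟨c, hc, ?_⟩
    rw [hFz, eq_div_iff (by linarith)] at h
    linarith
  have h0m : (0 : ℝ) ∈ Set.Icc 0 z := ⟨le_rfl, hz.le⟩
  have hzm : z ∈ Set.Icc 0 z := ⟨hz.le, le_rfl⟩
  constructor
  · obtain ⟨c, hc, h⟩ := hMVT 0 le_rfl hz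
    have hc' : c ∈ Set.Icc 0 z := ⟨hc.1.le, hc.2.le⟩
    have := hGanti h0m hc' hc.1
    rw [hG0] at this
    rw [hF0] at h
    nlinarith [mul_pos hM0 hz]
  · have hGz := hGpos z hzm
    have hpt : ∀ w, T w < 1 → 0 < F (T w * z) - M 0 * G z * z * (1 - T w) := by
      intro w hw
      obtain ⟨c, hc, h⟩ := hMVT (T w * z) (mul_nonneg (hT0 w) hz.le) (by nlinarith)
      have h1 : G z < G c := hGanti
        ⟨(mul_nonneg (hT0 w) hz.le).trans hc.1.le, hc.2.le⟩ hzm hc.2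
      rw [h]
      have h2 : 0 < M 0 * z * (1 - T w) := by
        have : 0 < 1 - T w := by linarith
        positivity
      nlinarith
    have hnn : 0 ≤ᵐ[P] fun w => F (T w * z) - M 0 * G z * z * (1 - T w) := by
      refine Filter.Eventually.of_forall fun w => ?_
      rcases (hT1 w).eq_or_lt with h | h
      · simp [h, hFz]
      · exact (hpt w h).le
    have hint1 : Integrable (fun w => M 0 * G z * z * (1 - T w)) P :=
      ((integrable_const 1).sub hTI).const_mul _
    have hI : ∫ w, (F (T w * z) - M 0 * G z * z * (1 - T w)) ∂P
        = G z - M 0 * G z * z * (1 - M 1 / M 0) := by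
      rw [integral_sub (hFint z) hint1, integral_const_mul,
        integral_sub (integrable_const 1) hTI, hTE]
      simp [hG]
    have hpos : 0 < ∫ w, (F (T w * z) - M 0 * G z * z * (1 - T w)) ∂P := by
      refine lt_of_le_of_ne (integral_nonneg_of_ae hnn) ?_
      intro h
      have h2 := (integral_eq_zero_iff_of_nonneg_ae hnn ((hFint z).sub hint1)).1 h.symm
      apply hTn1
      filter_upwards [h2] with w hw
      by_contra hne
      exact (hpt w (lt_of_le_of_ne (hT1 w) hne)).ne' hw
    rw [hI] at hpos
    have e : G z - M 0 * G z * z * (1 - M 1 / M 0) = G z * (1 - z * (M 0 - M 1)) := by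
      field_simp
    rw [e] at hpos
    have := pos_of_mul_pos_right hpos hGz.le
    linarith

open MeasureTheory in
theorem hb_moment {m : ℕ} (σ : Fin m → ℝ) (hσ : ∀ j, -1 < σ j) (k : ℕ) :
    ∫ w : Fin m → unitInterval, (∏ j, (w j : ℝ) ^ (1 / (σ j + 1))) ^ k
      = ∏ j, (σ j + 1) / (σ j + 1 + k) := by
  simp_rw [← Finset.prod_pow]
  rw [integral_fintype_prod_volume_eq_prod (E := fun _ : Fin m => unitInterval)
    (fun j (x : unitInterval) => ((x : ℝ) ^ (1 / (σ j + 1))) ^ k)]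
  refine Finset.prod_congr rfl fun j _ => ?_
  have hs : 0 < σ j + 1 := by linarith [hσ j]
  have h1 : ∫ x : unitInterval, ((x : ℝ) ^ (1 / (σ j + 1))) ^ k
      = ∫ x in Set.Icc (0 : ℝ) 1, (x ^ (1 / (σ j + 1))) ^ k :=
    integral_subtype_comap measurableSet_Icc (fun x : ℝ => (x ^ (1 / (σ j + 1))) ^ k)
  rw [h1, integral_Icc_eq_integral_Ioc, ← intervalIntegral.integral_of_le zero_le_one]
  have h2 : ∫ x in (0 : ℝ)..1, (x ^ (1 / (σ j + 1))) ^ k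
      = ∫ x in (0 : ℝ)..1, x ^ (1 / (σ j + 1) * k) := by
    apply intervalIntegral.integral_congr
    intro x hx
    rw [Set.uIcc_of_le zero_le_one] at hx
    simp only
    rw [Real.rpow_mul hx.1, Real.rpow_natCast]
  have h3 : 0 ≤ 1 / (σ j + 1) * k := by positivity
  rw [h2, integral_rpow (Or.inl (by linarith)), Real.one_rpow, Real.zero_rpow (by linarith)]
  field_simp
  ring

theorem hyperBessel_first_zero_bounds {m : ℕ} (hm : 1 ≤ m) (σ : Fin m → ℝ)
    (hσ : ∀ j, -1 < σ j) (μ : ℕ → ℝ) (hμ : ∀ k, μ k = ∏ j, (σ j + k)⁻¹)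
    (j₁ : ℝ) (hj₁ : 0 < j₁) (hzero : hyperBessel m σ j₁ = 0)
    (hfirst : ∀ y ∈ Set.Ioo (0 : ℝ) j₁, hyperBessel m σ y ≠ 0) :
    (m + 1) * μ 1 ^ (-(1 / ((m : ℝ) + 1))) < j₁ ∧
      j₁ < (m + 1) * (μ 1 - μ 2) ^ (-(1 / ((m : ℝ) + 1))) := by
  have hs : ∀ j, 0 < σ j + 1 := fun j => by linarith [hσ j]
  have hsk : ∀ j (k : ℕ), 0 < σ j + 1 + k := fun j k => by
    have := hs j
    positivity
  have hm1 : (0 : ℝ) < m + 1 := by positivity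
  set a : ℕ → ℝ := fun k =>
    1 / ((∏ j, Real.Gamma (σ j + 1 + k) / Real.Gamma (σ j + 1)) * k.factorial) with ha
  have hFa : ∀ x, hyperF m σ x = ∑' k, a k * (-(x / (m + 1)) ^ (m + 1)) ^ k := by
    intro x
    unfold hyperF
    congr 1
    ext k
    simp only [ha]
    ring
  have hJF : ∀ x, 0 < x → (hyperBessel m σ x = 0 ↔ hyperF m σ x = 0) := by
    intro x hx
    unfold hyperBessel
    have h1 : 0 < (x / (m + 1)) ^ (∑ j, σ j) := Real.rpow_pos_of_pos (by positivity) _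
    have h2 : 0 < ∏ j, Real.Gamma (σ j + 1) :=
      Finset.prod_pos fun j _ => Real.Gamma_pos_of_pos (hs j)
    rw [mul_eq_zero, or_iff_right (div_pos h1 h2).ne']
  have hμ' : ∀ k : ℕ, μ (k + 1) = ∏ j, (σ j + 1 + k)⁻¹ := by
    intro k
    rw [hμ]
    refine Finset.prod_congr rfl fun j _ => ?_
    push_cast
    ring_nf
  have hμpos : ∀ k : ℕ, 0 < μ (k + 1) := by
    intro k
    rw [hμ']
    exact Finset.prod_pos fun j _ => inv_pos.2 (hsk j k)
  have hlt : μ 2 < μ 1 := by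
    have e1 := hμ' 1
    have e0 := hμ' 0
    norm_num at e1 e0
    rw [e1, e0, ← Finset.prod_inv_distrib, ← Finset.prod_inv_distrib]
    refine Finset.prod_lt_prod_of_nonempty ?_ ?_ ?_
    · intro j _
      have := hs j
      positivity
    · intro j _
      have := hs j
      exact inv_strictAnti₀ this (by linarith)
    · exact ⟨⟨0, hm⟩, Finset.mem_univ _⟩
  set z := (j₁ / (m + 1)) ^ (m + 1) with hz
  have hz0 : 0 < z := by positivity
  have hcore := hb_core (MeasureTheory.volume : MeasureTheory.Measure (Fin m → unitInterval))
    (fun w => ∏ j, (w j : ℝ) ^ (1 / (σ j + 1))) (by fun_prop)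
    (fun w => Finset.prod_nonneg fun j _ => Real.rpow_nonneg (w j).2.1 _)
    (fun w => Finset.prod_le_one (fun j _ => Real.rpow_nonneg (w j).2.1 _)
      (fun j _ => Real.rpow_le_one (w j).2.1 (w j).2.2 (by have := hs j; positivity)))
    (fun k => μ (k + 1)) a (hμpos 0) ?_ hlt (hμpos 1) ?_ ?_ z hz0 ?_ ?_
  · obtain ⟨h1, h2⟩ := hcore
    simp only [zero_add] at h1 h2
    norm_num at h1 h2
    have hroot : j₁ = (m + 1) * z ^ (1 / ((m : ℝ) + 1)) := by
      have : z ^ (1 / ((m : ℝ) + 1)) = j₁ / (m + 1) := by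
        rw [hz, one_div]
        have := Real.pow_rpow_inv_natCast (x := j₁ / (m + 1)) (by positivity)
          (Nat.succ_ne_zero m)
        simpa using this
      rw [this]; field_simp
    have hμ1 : 0 < μ 1 := hμpos 0
    have hd : 0 < μ 1 - μ 2 := by linarith
    have hp : 0 < 1 / ((m : ℝ) + 1) := by positivity
    rw [Real.rpow_neg hμ1.le, Real.rpow_neg hd.le, ← Real.inv_rpow hμ1.le, ← Real.inv_rpow hd.le]
    constructor
    · rw [hroot]
      refine mul_lt_mul_of_pos_left (Real.rpow_lt_rpow (by positivity) ?_ hp) hm1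
      rw [inv_lt_iff_one_lt_mul₀ hμ1]; linarith
    · rw [hroot]
      refine mul_lt_mul_of_pos_left (Real.rpow_lt_rpow hz0.le ?_ hp) hm1
      rw [lt_inv_comm₀ hz0 hd, ← one_div, lt_div_iff₀ hz0]; linarith
  · intro k
    rw [hb_moment σ hσ k, hμ', hμ', ← Finset.prod_div_distrib]
    refine Finset.prod_congr rfl fun j _ => ?_
    have := hs j
    have := hsk j k
    simp only [Nat.cast_zero, add_zero]
    field_simp
  · simp only [ha]
    have : ∀ j, Real.Gamma (σ j + 1) / Real.Gamma (σ j + 1) = 1 := fun j =>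
      div_self (Real.Gamma_pos_of_pos (hs j)).ne'
    simp [this]
  · intro k
    simp only [ha]
    have e : ∏ j, Real.Gamma (σ j + 1 + (k + 1 : ℕ)) / Real.Gamma (σ j + 1)
        = (∏ j, (σ j + 1 + k)) * ∏ j, Real.Gamma (σ j + 1 + k) / Real.Gamma (σ j + 1) := by
      rw [← Finset.prod_mul_distrib]
      refine Finset.prod_congr rfl fun j _ => ?_
      rw [Nat.cast_add_one, ← add_assoc, Real.Gamma_add_one (hsk j k).ne', mul_div_assoc]
    rw [e, hμ', Finset.prod_inv_distrib, Nat.factorial_succ]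
    have h1 : 0 < ∏ j, (σ j + 1 + k) := Finset.prod_pos fun j _ => hsk j k
    have h2 : 0 < ∏ j, Real.Gamma (σ j + 1 + k) / Real.Gamma (σ j + 1) :=
      Finset.prod_pos fun j _ => div_pos (Real.Gamma_pos_of_pos (hsk j k))
        (Real.Gamma_pos_of_pos (hs j))
    generalize (∏ j, (σ j + 1 + k)) = A at *
    generalize (∏ j, Real.Gamma (σ j + 1 + k) / Real.Gamma (σ j + 1)) = B at *
    push_cast
    field_simp
  · rw [← hFa]
    exact (hJF j₁ hj₁).1 hzero
  · intro y hy h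
    set r := y ^ (((m + 1 : ℕ) : ℝ)⁻¹) with hr
    have hr0 : 0 < r := Real.rpow_pos_of_pos hy.1 _
    have hry : r ^ (m + 1) = y := Real.rpow_inv_natCast_pow hy.1.le (Nat.succ_ne_zero m)
    have hx : (m + 1) * r / (m + 1) = r := by field_simp
    refine hfirst ((m + 1) * r) ⟨by positivity, ?_⟩ ?_
    · have : r < j₁ / (m + 1) := by
        apply lt_of_pow_lt_pow_left₀ (m + 1) (by positivity)
        rw [hry]; exact hy.2
      rw [lt_div_iff₀ hm1] at this
      linarith
    · rw [hJF _ (by positivity), hFa, hx, hry]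
      exact h
end
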